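/- Let k ≥ 1 and let α = (α₁,…,α_m) be a partition of k with m parts. Then the genus-zero Hurwitz number over the sphere is given by μ_{0,m}^{0,k}(α) = (|c_α|/k!)·(k + m − 2)!·k^{m−3}·Π_{i=1}^m α_i^{α_i}/(α_i − 1)!. -/

import Mathlib

/-!
The Hurwitz formula (1.7) for genus-zero Hurwitz numbers over the sphere:
`μ_{0,m}^{0,k}(α) = (|c_α|/k!)·(k+m-2)!·k^{m-3}·Π α_i^{α_i}/(α_i-1)!`.
-/

/-- The cycle type of a permutation of `Fin k`, counting fixed points as
cycles of length 1. -/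
def fullCycleType {k : ℕ} (σ : Equiv.Perm (Fin k)) : Multiset ℕ :=
  σ.cycleType + Multiset.replicate (k - σ.support.card) 1

/-- The number of tuples `(t₁,…,t_r,σ)` in `S_k` such that each `t_i` is a
transposition, `σ` has cycle type `α` (fixed points counted as 1-cycles),
`t₁⋯t_r·σ = 1`, and the generated subgroup is transitive on `{1,…,k}`. -/
noncomputable def hurwitzCount0 (k r : ℕ) (α : Multiset ℕ) : ℕ :=
  Nat.card {T : (Fin r → Equiv.Perm (Fin k)) × Equiv.Perm (Fin k) //
    (∀ i, (T.1 i).IsSwap) ∧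
    fullCycleType T.2 = α ∧
    (List.ofFn T.1).prod * T.2 = 1 ∧
    ∀ x y : Fin k, ∃ g ∈ Subgroup.closure (Set.range T.1 ∪ {T.2}), g x = y}

/-- The Hurwitz number `μ_{0,m}^{g,k}(α)` over the sphere (`h = 0`), with
`m = α.card` and `r = k + m - 2 + 2g` transpositions. -/
noncomputable def hurwitzSphere (g k : ℕ) (α : Multiset ℕ) : ℚ :=
  (hurwitzCount0 k (k + α.card - 2 + 2 * g) α : ℚ) / k.factorial

/-- `|c_α|`, the cardinality of the conjugacy class of `S_k` of cycle type
`α`: `k!/(Π_i α_i · Π_j m_j!)` where `m_j` is the multiplicity of `j` in `α`. -/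
noncomputable def conjClassCard (k : ℕ) (α : Multiset ℕ) : ℚ :=
  (k.factorial : ℚ) /
    ((α.prod : ℚ) * ∏ j ∈ α.toFinset, ((α.count j).factorial : ℚ))

section Preliminaries

open Finset

/-- Alternating sums over subsets kill powers of low degree. -/
lemma sum_powerset_neg_one_pow_mul_add_pow_eq_zero {ι : Type*} [DecidableEq ι] (α : ι → ℚ)
    (S : Finset ι) : ∀ (x : ℚ) (n : ℕ), n < #S →
      ∑ A ∈ S.powerset, (-1) ^ #A * (x + ∑ i ∈ A, α i) ^ n = 0 := by
  induction S using Finset.induction_on with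
  | empty => intro x n hn; simp at hn
  | insert s S hs ih =>
    intro x n hn
    rw [card_insert_of_notMem hs] at hn
    rw [sum_powerset_insert hs, ← sum_add_distrib]
    have key : ∀ A ∈ S.powerset, (-1 : ℚ) ^ #A * (x + ∑ i ∈ A, α i) ^ n +
        (-1) ^ #(insert s A) * (x + ∑ i ∈ insert s A, α i) ^ n =
        -∑ i ∈ range n, α s ^ (n - i) * (n.choose i : ℚ) *
          ((-1) ^ #A * (x + ∑ i ∈ A, α i) ^ i) := by
      intro A hA
      have hsA : s ∉ A := fun h => hs (mem_powerset.1 hA h)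
      have e := add_pow (x + ∑ i ∈ A, α i) (α s) n
      rw [sum_range_succ, Nat.sub_self, pow_zero, Nat.choose_self, Nat.cast_one] at e
      rw [card_insert_of_notMem hsA, sum_insert hsA, add_left_comm, add_comm (α s), e, pow_succ,
        ← sum_neg_distrib]
      simp only [mul_one, mul_add, mul_neg, neg_mul, mul_sum, sum_neg_distrib]
      rw [sum_congr rfl fun i _ => show (-1 : ℚ) ^ #A * ((x + ∑ i ∈ A, α i) ^ i * α s ^ (n - i) *
        (n.choose i : ℚ)) = α s ^ (n - i) * (n.choose i : ℚ) * ((-1) ^ #A *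
          (x + ∑ i ∈ A, α i) ^ i) by ring]
      ring
    rw [sum_congr rfl key, sum_neg_distrib, sum_comm, neg_eq_zero]
    refine sum_eq_zero fun i hi => ?_
    rw [← mul_sum, ih x i (by have := mem_range.1 hi; omega), mul_zero]

/-- Hurwitz's multivariate generalization of Abel's binomial theorem. -/
lemma hurwitz_abel {ι : Type*} [DecidableEq ι] (α : ι → ℚ) (hα : ∀ i, 0 ≤ α i)
    (x : ℚ) (hx : 0 < x) (S : Finset ι) : ∀ y : ℚ,
      ∑ A ∈ S.powerset, x * (x + ∑ i ∈ A, α i) ^ ((#A : ℤ) - 1) *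
        (y + ∑ i ∈ S \ A, α i) ^ #(S \ A) = (x + y + ∑ i ∈ S, α i) ^ #S := by
  induction S using Finset.strongInduction with
  | H S ih =>
  rcases S.eq_empty_or_nonempty with rfl | hne
  · intro y; simp [hx.ne']
  open Polynomial in
  set p : ℚ[X] := ∑ A ∈ S.powerset, C (x * (x + ∑ i ∈ A, α i) ^ ((#A : ℤ) - 1)) *
      (X + C (∑ i ∈ S \ A, α i)) ^ #(S \ A) with hp
  open Polynomial in
  set q : ℚ[X] := (X + C (x + ∑ i ∈ S, α i)) ^ #S with hq
  have hd : Polynomial.derivative p = Polynomial.derivative q := by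
    apply Polynomial.funext
    intro y
    have h1 : ∀ A ∈ S.powerset, (x * (x + ∑ i ∈ A, α i) ^ ((#A : ℤ) - 1)) *
        ((#(S \ A) : ℚ) * (y + ∑ i ∈ S \ A, α i) ^ (#(S \ A) - 1)) =
        ∑ s ∈ S \ A, (x * (x + ∑ i ∈ A, α i) ^ ((#A : ℤ) - 1)) *
          ((y + α s) + ∑ i ∈ (S.erase s) \ A, α i) ^ #((S.erase s) \ A) := by
      intro A hA
      rw [← nsmul_eq_mul, ← sum_const, mul_sum]
      refine sum_congr rfl fun s hs => ?_
      rw [erase_sdiff_comm, card_erase_of_mem hs, add_assoc, add_sum_erase _ _ hs]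
    have h2 : ∑ A ∈ S.powerset, ∑ s ∈ S \ A, (x * (x + ∑ i ∈ A, α i) ^ ((#A : ℤ) - 1)) *
          ((y + α s) + ∑ i ∈ (S.erase s) \ A, α i) ^ #((S.erase s) \ A) =
        ∑ s ∈ S, ∑ A ∈ (S.erase s).powerset, (x * (x + ∑ i ∈ A, α i) ^ ((#A : ℤ) - 1)) *
          ((y + α s) + ∑ i ∈ (S.erase s) \ A, α i) ^ #((S.erase s) \ A) := by
      apply sum_comm'
      intro A s
      simp only [mem_powerset, mem_sdiff, subset_erase]
      tauto
    simp only [hp, hq, Polynomial.derivative_sum, Polynomial.derivative_C_mul,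
      Polynomial.derivative_X_add_C_pow, Polynomial.eval_finsetSum, Polynomial.eval_mul,
      Polynomial.eval_C, Polynomial.eval_pow, Polynomial.eval_add, Polynomial.eval_X]
    rw [sum_congr rfl h1, h2]
    have h3 : ∀ s ∈ S, ∑ A ∈ (S.erase s).powerset, (x * (x + ∑ i ∈ A, α i) ^ ((#A : ℤ) - 1)) *
          ((y + α s) + ∑ i ∈ (S.erase s) \ A, α i) ^ #((S.erase s) \ A) =
          (y + (x + ∑ i ∈ S, α i)) ^ (#S - 1) := by
      intro s hs
      rw [ih _ (erase_ssubset hs), card_erase_of_mem hs, ← add_sum_erase _ _ hs]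
      ring
    rw [sum_congr rfl h3]
    simp
  have hpq : p - q = 0 := by
    have h0 : Polynomial.derivative (p - q) = 0 := by
      rw [Polynomial.derivative_sub, hd, sub_self]
    have h1 := Polynomial.eq_C_of_natDegree_eq_zero
      (Polynomial.derivative_eq_zero.1 h0)
    have h2 : Polynomial.eval (-(x + ∑ i ∈ S, α i)) (p - q) = 0 := by
      have hS : #S ≠ 0 := by simpa using hne.ne_empty
      simp only [hp, hq, Polynomial.eval_sub, Polynomial.eval_finsetSum, Polynomial.eval_mul,
        Polynomial.eval_C, Polynomial.eval_pow, Polynomial.eval_add, Polynomial.eval_X,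
        neg_add_cancel, ne_eq, hS, not_false_eq_true, zero_pow, sub_zero]
      have h3 := sum_powerset_neg_one_pow_mul_add_pow_eq_zero α S x (#S - 1) (by omega)
      have h4 : ∀ A ∈ S.powerset, x * (x + ∑ i ∈ A, α i) ^ ((#A : ℤ) - 1) *
          (-(x + ∑ i ∈ S, α i) + ∑ i ∈ S \ A, α i) ^ #(S \ A) =
          x * (-1) ^ #S * ((-1) ^ #A * (x + ∑ i ∈ A, α i) ^ (#S - 1)) := by
        intro A hA
        have hA' := mem_powerset.1 hA
        have hz : 0 < x + ∑ i ∈ A, α i := add_pos_of_pos_of_nonneg hx (sum_nonneg fun i _ => hα i)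
        have hc := card_sdiff_add_card_eq_card hA'
        have e1 : -(x + ∑ i ∈ S, α i) + ∑ i ∈ S \ A, α i = -1 * (x + ∑ i ∈ A, α i) := by
          rw [← sum_sdiff hA']; ring
        rw [e1, mul_pow]
        have e2 : (x + ∑ i ∈ A, α i) ^ (#S - 1) = (x + ∑ i ∈ A, α i) ^ ((#A : ℤ) - 1) *
            (x + ∑ i ∈ A, α i) ^ #(S \ A) := by
          rw [← zpow_natCast, ← zpow_natCast, ← zpow_add₀ hz.ne']
          congr 1
          omega
        have e3 : (-1 : ℚ) ^ #(S \ A) = (-1) ^ #S * (-1) ^ #A := by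
          rw [← hc, pow_add, mul_assoc, ← mul_pow]; simp
        rw [e2, e3]; ring
      rw [sum_congr rfl h4, ← mul_sum, h3, mul_zero]
    rw [h1, Polynomial.eval_C] at h2
    rw [h1, h2, Polynomial.C_0]
  intro y
  have := congrArg (Polynomial.eval y) (sub_eq_zero.1 hpq)
  simp only [hp, hq, Polynomial.eval_finsetSum, Polynomial.eval_mul,
      Polynomial.eval_C, Polynomial.eval_pow, Polynomial.eval_add, Polynomial.eval_X] at this
  rw [this]; ring

/-- The ratio `n ^ n / n!`. -/
def powSelfDivFactorial (n : ℕ) : ℚ := (n : ℚ) ^ n / (n.factorial : ℚ)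

lemma powSelfDivFactorial_pos {n : ℕ} (hn : 0 < n) : 0 < powSelfDivFactorial n := by
  unfold powSelfDivFactorial; positivity

/-- Abel's binomial theorem. -/
lemma abel_sum (x y : ℚ) (hx : 0 < x) (N : ℕ) :
    ∑ i ∈ range (N + 1), (N.choose i : ℚ) * (x * (x + i) ^ ((i : ℤ) - 1) *
      (y + (N - i : ℕ)) ^ (N - i)) = (x + y + N) ^ N := by
  have h := hurwitz_abel (fun _ : ℕ => (1 : ℚ)) (fun _ => zero_le_one) x hx (range N) y
  rw [sum_powerset] at h
  simp only [card_range, sum_const, nsmul_eq_mul, mul_one] at h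
  rw [← h]
  refine sum_congr rfl fun i _ => ?_
  have h2 : ∀ A ∈ powersetCard i (range N), x * (x + (#A : ℚ)) ^ ((#A : ℤ) - 1) *
      (y + (#(range N \ A) : ℚ)) ^ #(range N \ A) = x * (x + i) ^ ((i : ℤ) - 1) *
      (y + (N - i : ℕ)) ^ (N - i) := by
    intro A hA
    obtain ⟨h3, h4⟩ := mem_powersetCard.1 hA
    rw [card_sdiff_of_subset h3, card_range, h4]
  rw [sum_congr rfl h2, sum_const, card_powersetCard, card_range, nsmul_eq_mul]

lemma sum_powSelfDivFactorial_mul_div (a : ℕ) (ha : 0 < a) :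
    ∑ c ∈ Ico 1 a, powSelfDivFactorial c * powSelfDivFactorial (a - c) / (a - c : ℕ) =
      powSelfDivFactorial a * (1 - 1 / a) := by
  obtain ⟨N, rfl⟩ : ∃ N, a = N + 1 := ⟨a - 1, by omega⟩
  have h := abel_sum 1 0 one_pos N
  rw [sum_range_succ, Nat.sub_self, Nat.choose_self] at h
  have key : ∑ c ∈ Ico 1 (N + 1), powSelfDivFactorial c * powSelfDivFactorial (N + 1 - c) /
      (N + 1 - c : ℕ) = ∑ i ∈ range N, (1 / (N.factorial : ℚ)) * ((N.choose i : ℚ) *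
        (1 * (1 + (i : ℚ)) ^ ((i : ℤ) - 1) * (0 + ((N - i : ℕ) : ℚ)) ^ (N - i))) := by
    refine sum_nbij' (fun c => N - c) (fun i => N - i) ?_ ?_ ?_ ?_ ?_
    · intro c hc; simp at hc ⊢; omega
    · intro c hc; simp at hc ⊢; omega
    · intro c hc; simp at hc ⊢; omega
    · intro c hc; simp at hc ⊢; omega
    · intro c hc
      obtain ⟨h1, h2⟩ := mem_Ico.1 hc
      obtain ⟨i, rfl⟩ : ∃ i, N = c + i := ⟨N - c, by omega⟩
      have e1 : c + i + 1 - c = i + 1 := by omega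
      have e2 : c + i - c = i := by omega
      have e3 : c + i - i = c := by omega
      rw [e1, e2, e3, Nat.add_choose, Nat.cast_div
        (Nat.factorial_mul_factorial_dvd_factorial_add c i) (by positivity)]
      simp only [powSelfDivFactorial, Nat.factorial_succ]
      have hi : (1 + (i : ℚ)) ≠ 0 := by positivity
      rw [zpow_sub_one₀ hi, zpow_natCast]
      push_cast
      have hf : ((c + i).factorial : ℚ) ≠ 0 := by positivity
      field_simp
      ring
  rw [key, ← mul_sum, eq_sub_of_add_eq h]
  simp only [powSelfDivFactorial, Nat.factorial_succ]
  have hi : (1 + (N : ℚ)) ≠ 0 := by positivity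
  rw [zpow_sub_one₀ hi, zpow_natCast]
  push_cast
  field_simp
  ring

lemma sum_Ico_reflect_sub (a : ℕ) (f : ℕ → ℕ → ℚ) :
    ∑ c ∈ Ico 1 a, f c (a - c) = ∑ c ∈ Ico 1 a, f (a - c) c := by
  refine sum_nbij' (fun c => a - c) (fun i => a - i) ?_ ?_ ?_ ?_ ?_
  · intro c hc; simp at hc ⊢; omega
  · intro c hc; simp at hc ⊢; omega
  · intro c hc; simp at hc ⊢; omega
  · intro c hc; simp at hc ⊢; omega
  · intro c hc
    obtain ⟨h1, h2⟩ := mem_Ico.1 hc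
    rw [Nat.sub_sub_self h2.le]

/-- Re-expansion of `∑ e(c) e(a - c) / (c + b)`, where `e n = n ^ n / n!`, by Abel's theorem. -/
lemma sum_powSelfDivFactorial_div_add (a b : ℕ) (hb : 0 < b) :
    ∑ c ∈ range (a + 1), powSelfDivFactorial c * powSelfDivFactorial (a - c) / (c + b) =
      1 / (a.factorial : ℚ) * ∑ j ∈ range (a + 1),
        (a.choose j : ℚ) * (-b : ℚ) ^ j * (a + b : ℚ) ^ (a - j) / (b + j) := by
  have hb' : (0 : ℚ) < b := by exact_mod_cast hb
  have h1 : ∀ j ∈ range (a + 1),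
      (a.choose j : ℚ) * (-b : ℚ) ^ j * (a + b : ℚ) ^ (a - j) / (b + j) =
      ∑ c ∈ Ico j (a + 1), (a.choose c : ℚ) * (c.choose j : ℚ) * (-b : ℚ) ^ j *
        (b + c : ℚ) ^ ((c : ℤ) - j - 1) * (a - c : ℕ) ^ (a - c) := by
    intro j hj
    have hja : j ≤ a := by have := mem_range.1 hj; omega
    have h := abel_sum (b + j) 0 (by positivity) (a - j)
    have e0 : (b + j : ℚ) + 0 + ((a - j : ℕ) : ℚ) = a + b := by
      push_cast [Nat.cast_sub hja]; ring
    rw [e0] at h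
    rw [← h, mul_sum, sum_div, sum_Ico_eq_sum_range]
    have e1 : a + 1 - j = a - j + 1 := by omega
    rw [e1]
    refine sum_congr rfl fun i hi => ?_
    have hi' : i ≤ a - j := by have := mem_range.1 hi; omega
    have e2 : a - (j + i) = a - j - i := by omega
    have e3 : (a.choose (j + i) : ℚ) * ((j + i).choose j : ℚ) =
        (a.choose j : ℚ) * ((a - j).choose i : ℚ) := by
      have := Nat.choose_mul (n := a) (k := j + i) (s := j) (by omega)
      rw [Nat.add_sub_cancel_left] at this
      exact_mod_cast this
    have e4 : (((j + i : ℕ) : ℤ) - j - 1) = (i : ℤ) - 1 := by push_cast; ring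
    have e5 : (b : ℚ) + ((j + i : ℕ) : ℚ) = b + j + i := by push_cast; ring
    rw [e2, e3, e4, e5]
    have : (b + j : ℚ) ≠ 0 := by positivity
    field_simp
    ring
  rw [sum_congr rfl h1]
  have h2 : ∑ j ∈ range (a + 1), ∑ c ∈ Ico j (a + 1),
      (a.choose c : ℚ) * (c.choose j : ℚ) * (-b : ℚ) ^ j *
        (b + c : ℚ) ^ ((c : ℤ) - j - 1) * (a - c : ℕ) ^ (a - c) =
      ∑ c ∈ range (a + 1), ∑ j ∈ range (c + 1),
      (a.choose c : ℚ) * (c.choose j : ℚ) * (-b : ℚ) ^ j *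
        (b + c : ℚ) ^ ((c : ℤ) - j - 1) * (a - c : ℕ) ^ (a - c) := by
    apply sum_comm'
    intro x y
    simp only [mem_range, mem_Ico]
    omega
  rw [h2, mul_sum]
  refine sum_congr rfl fun c hc => ?_
  have hca : c ≤ a := by have := mem_range.1 hc; omega
  have hz : (b + c : ℚ) ≠ 0 := by positivity
  have h3 := add_pow (-b : ℚ) (b + c) c
  rw [neg_add_cancel_left] at h3
  have h4 : ∑ j ∈ range (c + 1), (a.choose c : ℚ) * (c.choose j : ℚ) * (-b : ℚ) ^ j *
        (b + c : ℚ) ^ ((c : ℤ) - j - 1) * (a - c : ℕ) ^ (a - c) =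
      (a.choose c : ℚ) * (c : ℚ) ^ c / (b + c) * (a - c : ℕ) ^ (a - c) := by
    rw [h3, mul_sum, sum_div, sum_mul]
    refine sum_congr rfl fun j hj => ?_
    have hj' : j ≤ c := by have := mem_range.1 hj; omega
    have : (b + c : ℚ) ^ ((c : ℤ) - j - 1) = (b + c : ℚ) ^ (c - j) / (b + c) := by
      rw [zpow_sub_one₀ hz, ← Nat.cast_sub hj', zpow_natCast]; rfl
    rw [this]
    ring
  rw [h4, Nat.choose_eq_factorial_div_factorial hca,
    Nat.cast_div (Nat.factorial_mul_factorial_dvd_factorial hca) (by positivity)]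
  simp only [powSelfDivFactorial]
  push_cast
  have hf : (a.factorial : ℚ) ≠ 0 := by positivity
  have hz' : (c + b : ℚ) ≠ 0 := by positivity
  field_simp
  ring

lemma hasDerivAt_pow_mul_sub_pow (n u : ℝ) (a b : ℕ) :
    HasDerivAt (fun u : ℝ => u ^ b * (n - u) ^ a)
      (b * (u ^ (b - 1) * (n - u) ^ a) - a * (u ^ b * (n - u) ^ (a - 1))) u := by
  have h := (hasDerivAt_pow b u).mul (((hasDerivAt_id u).const_sub n).pow a)
  refine h.congr_deriv ?_
  simp only [id_eq, Pi.pow_apply]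
  ring

lemma integral_pow_mul_sub_pow_sub (n s t : ℝ) (a b : ℕ) :
    b * (∫ u in s..t, u ^ (b - 1) * (n - u) ^ a) - a * ∫ u in s..t, u ^ b * (n - u) ^ (a - 1) =
      t ^ b * (n - t) ^ a - s ^ b * (n - s) ^ a := by
  rw [← intervalIntegral.integral_const_mul, ← intervalIntegral.integral_const_mul,
    ← intervalIntegral.integral_sub (Continuous.intervalIntegrable (by fun_prop) _ _)
      (Continuous.intervalIntegrable (by fun_prop) _ _)]
  exact intervalIntegral.integral_eq_sub_of_hasDerivAt
    (fun u _ => hasDerivAt_pow_mul_sub_pow n u a b)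
    (Continuous.intervalIntegrable (by fun_prop) _ _)

lemma integral_pow_mul_sub_pow (n : ℝ) (b : ℕ) : ∀ a : ℕ,
    ∫ u in (0 : ℝ)..n, u ^ b * (n - u) ^ a =
      n ^ (a + b + 1) * (a.factorial * b.factorial / (a + b + 1).factorial) := by
  induction b with
  | zero =>
    intro a
    have h := integral_pow_mul_sub_pow_sub n 0 n (a + 1) 0
    simp only [Nat.cast_zero, zero_mul, zero_sub, Nat.add_sub_cancel, pow_zero, one_mul, sub_self,
      sub_zero, ne_eq, Nat.add_eq_zero_iff, one_ne_zero, and_false, not_false_eq_true,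
      zero_pow] at h
    simp only [pow_zero, one_mul, add_zero, Nat.factorial_zero, Nat.factorial_succ]
    push_cast at h ⊢
    have : (a + 1 : ℝ) ≠ 0 := by positivity
    have h0 : (a.factorial : ℝ) ≠ 0 := by positivity
    field_simp
    linarith
  | succ b ih =>
    intro a
    have h := integral_pow_mul_sub_pow_sub n 0 n (a + 1) (b + 1)
    simp only [Nat.add_sub_cancel, sub_self, ne_eq, Nat.add_eq_zero_iff, one_ne_zero, and_false,
      not_false_eq_true, zero_pow, mul_zero, zero_mul] at h
    rw [ih (a + 1)] at h
    have e : a + (b + 1) + 1 = a + 1 + b + 1 := by ring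
    rw [e]
    have : (a + 1 : ℝ) ≠ 0 := by positivity
    apply mul_left_cancel₀ this
    push_cast at h
    rw [← sub_eq_zero.1 h, Nat.factorial_succ a, Nat.factorial_succ b]
    push_cast
    ring

lemma integral_pow_mul_add_sub_pow (a b : ℕ) (hb : 0 < b) :
    ∫ u in (0 : ℝ)..b, u ^ (b - 1) * ((a + b : ℝ) - u) ^ a =
      (b : ℝ) ^ b * ∑ j ∈ range (a + 1),
        (a.choose j : ℝ) * (-b : ℝ) ^ j * (a + b : ℝ) ^ (a - j) / (b + j) := by
  have h1 : ∀ u : ℝ, u ^ (b - 1) * ((a + b : ℝ) - u) ^ a = ∑ j ∈ range (a + 1),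
      ((a.choose j : ℝ) * (-1 : ℝ) ^ j * (a + b : ℝ) ^ (a - j)) * u ^ (b - 1 + j) := by
    intro u
    rw [sub_eq_neg_add, add_pow, mul_sum]
    refine sum_congr rfl fun j _ => ?_
    rw [neg_pow u, pow_add]; ring
  simp_rw [h1]
  rw [intervalIntegral.integral_finsetSum
    fun j _ => Continuous.intervalIntegrable (by fun_prop) _ _, mul_sum]
  refine sum_congr rfl fun j _ => ?_
  rw [intervalIntegral.integral_const_mul, integral_pow]
  have e : b - 1 + j + 1 = b + j := by omega
  have e' : ((b - 1 + j : ℕ) : ℝ) + 1 = b + j := by exact_mod_cast e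
  rw [e, e', zero_pow (by omega), neg_pow (b : ℝ), pow_add]
  ring

lemma powSelfDivFactorial_add_full (a b : ℕ) (ha : 0 < a) (hb : 0 < b) :
    powSelfDivFactorial (a + b) + powSelfDivFactorial a * powSelfDivFactorial b =
      b * powSelfDivFactorial b *
        ∑ c ∈ range (a + 1), powSelfDivFactorial c * powSelfDivFactorial (a - c) / (c + b) +
      a * powSelfDivFactorial a *
        ∑ c ∈ range (b + 1), powSelfDivFactorial c * powSelfDivFactorial (b - c) / (c + a) := by
  rw [sum_powSelfDivFactorial_div_add a b hb, sum_powSelfDivFactorial_div_add b a ha]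
  have h1 := integral_pow_mul_add_sub_pow a b hb
  have h2 := integral_pow_mul_add_sub_pow b a ha
  have h3 := integral_pow_mul_sub_pow_sub (a + b : ℝ) 0 b a b
  have h4 : ∫ u in (0 : ℝ)..a, u ^ (a - 1) * ((b + a : ℝ) - u) ^ b =
      ∫ u in (b : ℝ)..(a + b), u ^ b * ((a + b : ℝ) - u) ^ (a - 1) := by
    have := intervalIntegral.integral_comp_sub_left (a := (0 : ℝ)) (b := a)
      (fun u : ℝ => u ^ b * ((a + b : ℝ) - u) ^ (a - 1)) (a + b : ℝ)
    rw [add_sub_cancel_left, sub_zero] at this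
    rw [← this]
    congr 1
    funext u
    rw [sub_sub_cancel, add_comm (b : ℝ)]
    ring
  have h5 := intervalIntegral.integral_add_adjacent_intervals (μ := MeasureTheory.volume)
    (f := fun u : ℝ => u ^ b * ((a + b : ℝ) - u) ^ (a - 1)) (a := 0) (b := b) (c := a + b)
    (Continuous.intervalIntegrable (by fun_prop) _ _)
    (Continuous.intervalIntegrable (by fun_prop) _ _)
  rw [integral_pow_mul_sub_pow] at h5
  rw [h4] at h2
  rw [h1] at h3
  rw [h2] at h5
  have e1 : a - 1 + b + 1 = a + b := by omega
  rw [add_sub_cancel_right, zero_pow hb.ne', zero_mul, sub_zero] at h3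
  rw [e1] at h5
  have e2 : (a : ℝ) * (a - 1).factorial = a.factorial := by
    exact_mod_cast Nat.mul_factorial_pred ha.ne'
  have h6 : ((a : ℝ) + b) ^ (a + b) * (a.factorial * b.factorial / (a + b).factorial) +
      (b : ℝ) ^ b * (a : ℝ) ^ a = b * ((b : ℝ) ^ b * ∑ j ∈ range (a + 1),
        (a.choose j : ℝ) * (-b : ℝ) ^ j * (a + b : ℝ) ^ (a - j) / (b + j)) +
      a * ((a : ℝ) ^ a * ∑ j ∈ range (b + 1),
        (b.choose j : ℝ) * (-a : ℝ) ^ j * (b + a : ℝ) ^ (b - j) / (a + j)) := by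
    rw [← h3, ← e2]
    linear_combination (-(a : ℝ)) * h5
  have h7 : ((a : ℚ) + b) ^ (a + b) * (a.factorial * b.factorial / (a + b).factorial) +
      (b : ℚ) ^ b * (a : ℚ) ^ a = b * ((b : ℚ) ^ b * ∑ j ∈ range (a + 1),
        (a.choose j : ℚ) * (-b : ℚ) ^ j * (a + b : ℚ) ^ (a - j) / (b + j)) +
      a * ((a : ℚ) ^ a * ∑ j ∈ range (b + 1),
        (b.choose j : ℚ) * (-a : ℚ) ^ j * (b + a : ℚ) ^ (b - j) / (a + j)) := by
    apply Rat.cast_injective (α := ℝ)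
    push_cast
    exact h6
  simp only [powSelfDivFactorial]
  have hfa : (a.factorial : ℚ) ≠ 0 := by positivity
  have hfb : (b.factorial : ℚ) ≠ 0 := by positivity
  apply mul_left_cancel₀ (mul_ne_zero hfa hfb)
  push_cast
  field_simp
  field_simp at h7
  linear_combination h7

/-- The two-cycle identity underlying the cut-and-join recursion. -/
lemma two_mul_powSelfDivFactorial_mul (a b : ℕ) (ha : 0 < a) (hb : 0 < b) :
    2 * powSelfDivFactorial a * powSelfDivFactorial b = powSelfDivFactorial (a + b) -
      b * powSelfDivFactorial b *
        ∑ c ∈ Ico 1 a, powSelfDivFactorial c * powSelfDivFactorial (a - c) / (c + b) -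
      a * powSelfDivFactorial a *
        ∑ c ∈ Ico 1 b, powSelfDivFactorial c * powSelfDivFactorial (b - c) / (c + a) := by
  have h := powSelfDivFactorial_add_full a b ha hb
  have key : ∀ a b : ℕ, 0 < a → ∑ c ∈ range (a + 1),
      powSelfDivFactorial c * powSelfDivFactorial (a - c) / (c + b : ℚ) =
      ∑ c ∈ Ico 1 a, powSelfDivFactorial c * powSelfDivFactorial (a - c) / (c + b : ℚ) +
        powSelfDivFactorial a / b + powSelfDivFactorial a / (a + b) := by
    intro a b ha
    rw [sum_range_succ, range_eq_Ico, sum_eq_sum_Ico_succ_bot ha]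
    simp [powSelfDivFactorial]
    ring
  rw [key a b ha, key b a hb] at h
  have hb' : (b : ℚ) ≠ 0 := by positivity
  have ha' : (a : ℚ) ≠ 0 := by positivity
  have hab : (a + b : ℚ) ≠ 0 := by positivity
  have e : b * powSelfDivFactorial b * (powSelfDivFactorial a / b + powSelfDivFactorial a / (a + b))
      + a * powSelfDivFactorial a *
      (powSelfDivFactorial b / a + powSelfDivFactorial b / (b + a)) =
      3 * powSelfDivFactorial a * powSelfDivFactorial b := by
    rw [add_comm (b : ℚ) a]
    field_simp
    ring
  linear_combination -h - e

/-- Hurwitz's identity in symmetric form. -/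
lemma hurwitz_abel_symm {ι : Type*} [DecidableEq ι] (α : ι → ℚ) (hα : ∀ i, 0 ≤ α i)
    (x y : ℚ) (hx : 0 < x) (hy : 0 < y) (S : Finset ι) :
    ∑ A ∈ S.powerset, (x * (x + ∑ i ∈ A, α i) ^ ((#A : ℤ) - 1)) *
        (y * (y + ∑ i ∈ S \ A, α i) ^ ((#(S \ A) : ℤ) - 1)) =
      (x + y) * (x + y + ∑ i ∈ S, α i) ^ ((#S : ℤ) - 1) := by
  have hB : ∀ B : Finset ι, y * (y + ∑ i ∈ B, α i) ^ ((#B : ℤ) - 1) =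
      (y + ∑ i ∈ B, α i) ^ #B - ∑ s ∈ B, α s *
        (y + α s + ∑ i ∈ B.erase s, α i) ^ #(B.erase s) := by
    intro B
    have hz : y + ∑ i ∈ B, α i ≠ 0 :=
      (add_pos_of_pos_of_nonneg hy (sum_nonneg fun i _ => hα i)).ne'
    have h1 : ∀ s ∈ B, α s * (y + α s + ∑ i ∈ B.erase s, α i) ^ #(B.erase s) =
        α s * (y + ∑ i ∈ B, α i) ^ ((#B : ℤ) - 1) := by
      intro s hs
      rw [add_assoc, add_sum_erase _ _ hs, ← zpow_natCast, card_erase_of_mem hs,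
        Nat.cast_sub (card_pos.2 ⟨s, hs⟩), Nat.cast_one]
    rw [sum_congr rfl h1, ← sum_mul, ← zpow_natCast, zpow_sub_one₀ hz]
    field_simp
    ring
  have hz : x + y + ∑ i ∈ S, α i ≠ 0 :=
    (add_pos_of_pos_of_nonneg (add_pos hx hy) (sum_nonneg fun i _ => hα i)).ne'
  simp_rw [hB, mul_sub, sum_sub_distrib, mul_sum]
  rw [hurwitz_abel α hα x hx]
  have h2 : ∑ A ∈ S.powerset, ∑ s ∈ S \ A, x * (x + ∑ i ∈ A, α i) ^ ((#A : ℤ) - 1) *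
        (α s * (y + α s + ∑ i ∈ (S \ A).erase s, α i) ^ #((S \ A).erase s)) =
      ∑ s ∈ S, ∑ A ∈ (S.erase s).powerset, α s * (x * (x + ∑ i ∈ A, α i) ^ ((#A : ℤ) - 1) *
        (y + α s + ∑ i ∈ (S.erase s) \ A, α i) ^ #((S.erase s) \ A)) := by
    simp_rw [erase_sdiff_comm]
    rw [sum_comm' (t' := S) (s' := fun s => (S.erase s).powerset)]
    · refine sum_congr rfl fun s _ => sum_congr rfl fun A _ => by ring
    · intro A s
      simp only [mem_powerset, mem_sdiff, subset_erase]
      tauto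
  have h3 : ∀ s ∈ S, ∑ A ∈ (S.erase s).powerset, α s *
      (x * (x + ∑ i ∈ A, α i) ^ ((#A : ℤ) - 1) *
        (y + α s + ∑ i ∈ (S.erase s) \ A, α i) ^ #((S.erase s) \ A)) =
      α s * (x + y + ∑ i ∈ S, α i) ^ ((#S : ℤ) - 1) := by
    intro s hs
    rw [← mul_sum, hurwitz_abel α hα x hx, ← zpow_natCast, card_erase_of_mem hs,
        Nat.cast_sub (card_pos.2 ⟨s, hs⟩), Nat.cast_one, ← add_sum_erase _ _ hs]
    congr 2
    ring
  rw [h2, sum_congr rfl h3, ← sum_mul, ← zpow_natCast, zpow_sub_one₀ hz]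
  field_simp
  ring

lemma sum_powerset_sum_erase {ι : Type*} [DecidableEq ι] (S : Finset ι)
    (f : ι → Finset ι → Finset ι → ℚ) :
    ∑ A ∈ S.powerset, ∑ s ∈ A, f s (A.erase s) (S \ A) =
      ∑ s ∈ S, ∑ A ∈ (S.erase s).powerset, f s A ((S.erase s) \ A) := by
  rw [sum_sigma', sum_sigma']
  refine sum_bij' (fun p _ => ⟨p.2, p.1.erase p.2⟩) (fun q _ => ⟨insert q.1 q.2, q.1⟩)
    ?_ ?_ ?_ ?_ ?_
  · rintro ⟨A, s⟩ h
    simp only [mem_sigma, mem_powerset] at h ⊢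
    exact ⟨h.1 h.2, erase_subset_erase _ h.1⟩
  · rintro ⟨s, A⟩ h
    simp only [mem_sigma, mem_powerset, subset_erase] at h ⊢
    exact ⟨insert_subset h.1 h.2.1, mem_insert_self _ _⟩
  · rintro ⟨A, s⟩ h
    simp only [mem_sigma, mem_powerset] at h ⊢
    simp [insert_erase h.2]
  · rintro ⟨s, A⟩ h
    simp only [mem_sigma, mem_powerset, subset_erase] at h ⊢
    simp [erase_insert h.2.2]
  · rintro ⟨A, s⟩ h
    simp only [mem_sigma, mem_powerset] at h ⊢
    congr 1
    ext i
    simp only [mem_sdiff, mem_erase]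
    by_cases hi : i = s
    · subst hi; simp [h.2]
    · simp [hi]

lemma sum_powerset_sum_erase_sdiff {ι : Type*} [DecidableEq ι] (S : Finset ι)
    (f : ι → Finset ι → Finset ι → ℚ) :
    ∑ A ∈ S.powerset, ∑ s ∈ S \ A, f s A ((S \ A).erase s) =
      ∑ s ∈ S, ∑ A ∈ (S.erase s).powerset, f s A ((S.erase s) \ A) := by
  simp_rw [erase_sdiff_comm]
  apply sum_comm'
  intro A s
  simp only [mem_powerset, mem_sdiff, subset_erase]
  tauto

lemma mul_zpow_sub_two_eq {ι : Type*} [DecidableEq ι] (α : ι → ℚ) (hα : ∀ i, 0 ≤ α i)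
    (x : ℚ) (hx : 0 < x) (A : Finset ι) :
    x ^ 2 * (x + ∑ i ∈ A, α i) ^ ((#A : ℤ) - 2) =
      x * (x + ∑ i ∈ A, α i) ^ ((#A : ℤ) - 1) - ∑ s ∈ A, α s * x / (x + α s) *
        ((x + α s) * (x + α s + ∑ i ∈ A.erase s, α i) ^ ((#(A.erase s) : ℤ) - 1)) := by
  have hz : x + ∑ i ∈ A, α i ≠ 0 :=
    (add_pos_of_pos_of_nonneg hx (sum_nonneg fun i _ => hα i)).ne'
  have h1 : ∀ s ∈ A, α s * x / (x + α s) *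
        ((x + α s) * (x + α s + ∑ i ∈ A.erase s, α i) ^ ((#(A.erase s) : ℤ) - 1)) =
      α s * (x * (x + ∑ i ∈ A, α i) ^ ((#A : ℤ) - 2)) := by
    intro s hs
    have : x + α s ≠ 0 := (add_pos_of_pos_of_nonneg hx (hα s)).ne'
    have e : ((#A - 1 : ℕ) : ℤ) - 1 = #A - 2 := by
      have := card_pos.2 ⟨s, hs⟩
      omega
    rw [add_assoc x, add_sum_erase _ _ hs, card_erase_of_mem hs, e]
    field_simp
  have e : (#A : ℤ) - 1 = (#A - 2) + 1 := by ring
  rw [sum_congr rfl h1, ← sum_mul, e, zpow_add_one₀ hz]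
  ring

/-- Hurwitz's convolution with both exponents lowered by two. -/
lemma hurwitz_abel_sub_two {ι : Type*} [DecidableEq ι] (α : ι → ℚ) (hα : ∀ i, 0 ≤ α i)
    (x y : ℚ) (hx : 0 < x) (hy : 0 < y) (S : Finset ι) (K : ℚ) (hK : K = x + y + ∑ i ∈ S, α i) :
    ∑ A ∈ S.powerset, (x ^ 2 * (x + ∑ i ∈ A, α i) ^ ((#A : ℤ) - 2)) *
        (y ^ 2 * (y + ∑ i ∈ S \ A, α i) ^ ((#(S \ A) : ℤ) - 2)) =
      (x + y) * K ^ ((#S : ℤ) - 1) -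
      (∑ s ∈ S, α s * (x / (x + α s) + y / (y + α s)) * (x + y + α s)) * K ^ ((#S : ℤ) - 2) +
      (∑ s ∈ S, ∑ t ∈ S.erase s, α s * α t * (x * y / ((x + α s) * (y + α t))) *
        (x + y + α s + α t)) * K ^ ((#S : ℤ) - 3) := by
  set P : ℚ → Finset ι → ℚ := fun x A => x * (x + ∑ i ∈ A, α i) ^ ((#A : ℤ) - 1) with hP
  have hconv : ∀ x y : ℚ, 0 < x → 0 < y → ∀ S : Finset ι,
      ∑ A ∈ S.powerset, P x A * P y (S \ A) = P (x + y) S :=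
    fun x y hx hy S => hurwitz_abel_symm α hα x y hx hy S
  have hpos : ∀ z : ℚ, 0 < z → ∀ s, 0 < z + α s :=
    fun z hz s => add_pos_of_pos_of_nonneg hz (hα s)
  have hF : ∀ x : ℚ, 0 < x → ∀ A : Finset ι, x ^ 2 * (x + ∑ i ∈ A, α i) ^ ((#A : ℤ) - 2) =
      P x A - ∑ s ∈ A, α s * x / (x + α s) * P (x + α s) (A.erase s) :=
    fun x hx A => mul_zpow_sub_two_eq α hα x hx A
  have hexp : ∀ A : Finset ι, (x ^ 2 * (x + ∑ i ∈ A, α i) ^ ((#A : ℤ) - 2)) *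
        (y ^ 2 * (y + ∑ i ∈ S \ A, α i) ^ ((#(S \ A) : ℤ) - 2)) =
      P x A * P y (S \ A) -
      ∑ s ∈ A, α s * x / (x + α s) * (P (x + α s) (A.erase s) * P y (S \ A)) -
      ∑ s ∈ S \ A, α s * y / (y + α s) * (P x A * P (y + α s) ((S \ A).erase s)) +
      ∑ s ∈ A, ∑ t ∈ S \ A, α s * x / (x + α s) * (α t * y / (y + α t)) *
        (P (x + α s) (A.erase s) * P (y + α t) ((S \ A).erase t)) := by
    intro A
    rw [hF x hx, hF y hy, sub_mul, mul_sub, mul_sub, mul_sum, sum_mul, sum_mul_sum]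
    have e1 : ∑ s ∈ S \ A, P x A * (α s * y / (y + α s) * P (y + α s) ((S \ A).erase s)) =
        ∑ s ∈ S \ A, α s * y / (y + α s) * (P x A * P (y + α s) ((S \ A).erase s)) :=
      sum_congr rfl fun s _ => by ring
    have e2 : ∑ s ∈ A, α s * x / (x + α s) * P (x + α s) (A.erase s) * P y (S \ A) =
        ∑ s ∈ A, α s * x / (x + α s) * (P (x + α s) (A.erase s) * P y (S \ A)) :=
      sum_congr rfl fun s _ => by ring
    have e3 : ∑ s ∈ A, ∑ t ∈ S \ A, α s * x / (x + α s) * P (x + α s) (A.erase s) *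
          (α t * y / (y + α t) * P (y + α t) ((S \ A).erase t)) =
        ∑ s ∈ A, ∑ t ∈ S \ A, α s * x / (x + α s) * (α t * y / (y + α t)) *
        (P (x + α s) (A.erase s) * P (y + α t) ((S \ A).erase t)) :=
      sum_congr rfl fun s _ => sum_congr rfl fun t _ => by ring
    rw [e1, e2, e3]
    ring
  simp_rw [hexp, sum_add_distrib, sum_sub_distrib]
  rw [hconv x y hx hy,
    sum_powerset_sum_erase S (fun s A B => α s * x / (x + α s) * (P (x + α s) A * P y B)),
    sum_powerset_sum_erase_sdiff S
      (fun s A B => α s * y / (y + α s) * (P x A * P (y + α s) B)),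
    sum_powerset_sum_erase S (fun s A B => ∑ t ∈ B, α s * x / (x + α s) * (α t * y / (y + α t)) *
        (P (x + α s) A * P (y + α t) (B.erase t)))]
  have t4 : ∀ s ∈ S, ∑ A ∈ (S.erase s).powerset, ∑ t ∈ S.erase s \ A,
      α s * x / (x + α s) * (α t * y / (y + α t)) *
        (P (x + α s) A * P (y + α t) ((S.erase s \ A).erase t)) =
      ∑ t ∈ S.erase s, α s * α t * (x * y / ((x + α s) * (y + α t))) *
        (x + y + α s + α t) * K ^ ((#S : ℤ) - 3) := by
    intro s hs
    rw [sum_powerset_sum_erase_sdiff (S.erase s) (fun t A B =>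
      α s * x / (x + α s) * (α t * y / (y + α t)) * (P (x + α s) A * P (y + α t) B))]
    refine sum_congr rfl fun t ht => ?_
    rw [← mul_sum, hconv _ _ (hpos x hx s) (hpos y hy t)]
    simp only [hP]
    have hxs := (hpos x hx s).ne'
    have hyt := (hpos y hy t).ne'
    have e : ((#((S.erase s).erase t) : ℕ) : ℤ) - 1 = #S - 3 := by
      have h1 := card_erase_add_one hs
      have h2 := card_erase_add_one ht
      omega
    have e' : x + α s + (y + α t) + ∑ i ∈ (S.erase s).erase t, α i = K := by
      rw [hK, ← add_sum_erase _ _ hs, ← add_sum_erase _ _ ht]; ring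
    rw [e, e']
    field_simp
    ring
  have t2 : ∀ s ∈ S, ∑ A ∈ (S.erase s).powerset,
      α s * x / (x + α s) * (P (x + α s) A * P y (S.erase s \ A)) =
      α s * (x / (x + α s)) * (x + y + α s) * K ^ ((#S : ℤ) - 2) := by
    intro s hs
    rw [← mul_sum, hconv _ _ (hpos x hx s) hy]
    simp only [hP]
    have e : ((#(S.erase s) : ℕ) : ℤ) - 1 = #S - 2 := by
      have h1 := card_erase_add_one hs
      omega
    have e' : x + α s + y + ∑ i ∈ S.erase s, α i = K := by
      rw [hK, ← add_sum_erase _ _ hs]; ring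
    rw [e, e']
    ring
  have t3 : ∀ s ∈ S, ∑ A ∈ (S.erase s).powerset,
      α s * y / (y + α s) * (P x A * P (y + α s) (S.erase s \ A)) =
      α s * (y / (y + α s)) * (x + y + α s) * K ^ ((#S : ℤ) - 2) := by
    intro s hs
    rw [← mul_sum, hconv _ _ hx (hpos y hy s)]
    simp only [hP]
    have e : ((#(S.erase s) : ℕ) : ℤ) - 1 = #S - 2 := by
      have h1 := card_erase_add_one hs
      omega
    have e' : x + (y + α s) + ∑ i ∈ S.erase s, α i = K := by
      rw [hK, ← add_sum_erase _ _ hs]; ring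
    rw [e, e']
    ring
  rw [sum_congr rfl t2, sum_congr rfl t3, sum_congr rfl t4]
  simp only [hP, ← hK, sum_mul]
  rw [sub_sub, ← sum_add_distrib]
  congr 2
  exact sum_congr rfl fun s _ => by ring

/-- The weight `n ^ n / (n - 1)!` of a cycle of length `n` in Hurwitz's formula. -/
def hurwitzWeight (n : ℕ) : ℚ := (n : ℚ) ^ n / ((n - 1).factorial : ℚ)

lemma hurwitzWeight_pos {n : ℕ} (hn : 0 < n) : 0 < hurwitzWeight n := by
  unfold hurwitzWeight; positivity

lemma hurwitzWeight_eq {n : ℕ} (hn : 0 < n) :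
    hurwitzWeight n = n * powSelfDivFactorial n := by
  unfold hurwitzWeight powSelfDivFactorial
  rw [← Nat.mul_factorial_pred hn.ne']
  push_cast
  have : (n : ℚ) ≠ 0 := by positivity
  field_simp

/-- The sum `∑ e(c) e(a - c) / (c + s)` over `0 < c < a`, where `e n = n ^ n / n!`. -/
def cutSum (a s : ℕ) : ℚ :=
  ∑ c ∈ Ico 1 a, powSelfDivFactorial c * powSelfDivFactorial (a - c) / (c + s)

lemma sum_powSelfDivFactorial_mul_div_mul (a : ℕ) (ha : 0 < a) :
    (∑ c ∈ Ico 1 a,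
      powSelfDivFactorial c * powSelfDivFactorial (a - c) / (c * (a - c : ℕ))) * a =
      2 * (powSelfDivFactorial a * (1 - 1 / a)) := by
  have h1 := sum_powSelfDivFactorial_mul_div a ha
  have h2 := sum_Ico_reflect_sub a
    (fun c d => powSelfDivFactorial c * powSelfDivFactorial d / d)
  have h3 : 2 * (powSelfDivFactorial a * (1 - 1 / a)) =
      ∑ c ∈ Ico 1 a, powSelfDivFactorial c * powSelfDivFactorial (a - c) / (a - c : ℕ) +
      ∑ c ∈ Ico 1 a, powSelfDivFactorial (a - c) * powSelfDivFactorial c / c := by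
    rw [← h2, h1, two_mul]
  rw [h3, ← sum_add_distrib, sum_mul]
  refine sum_congr rfl fun c hc => ?_
  obtain ⟨h3, h4⟩ := mem_Ico.1 hc
  obtain ⟨d, rfl⟩ : ∃ d, a = c + d := ⟨a - c, by omega⟩
  have hd : 0 < d := by omega
  rw [Nat.add_sub_cancel_left]
  push_cast
  field_simp

lemma sum_hurwitzWeight_cut {ι : Type*} [DecidableEq ι] (α : ι → ℕ) (a : ℕ) (ha : 0 < a)
    (R : Finset ι) (K : ℚ) (hK : K = a + ∑ i ∈ R, (α i : ℚ)) :
    ∑ c ∈ Ico 1 a, hurwitzWeight c * hurwitzWeight (a - c) *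
      ∑ A ∈ R.powerset, (c + ∑ i ∈ A, (α i : ℚ)) ^ ((#A : ℤ) - 2) *
        ((a - c : ℕ) + ∑ i ∈ R \ A, (α i : ℚ)) ^ ((#(R \ A) : ℤ) - 2) =
    2 * (powSelfDivFactorial a * (a - 1) * K ^ ((#R : ℤ) - 2) -
      K ^ ((#R : ℤ) - 3) * ∑ s ∈ R, α s * (a + α s) * cutSum a (α s)) := by
  have hKpos : 0 < K := by
    rw [hK]
    exact add_pos_of_pos_of_nonneg (by exact_mod_cast ha)
      (sum_nonneg fun i _ => Nat.cast_nonneg _)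
  have h1 : ∀ c ∈ Ico 1 a, hurwitzWeight c * hurwitzWeight (a - c) *
      ∑ A ∈ R.powerset, (c + ∑ i ∈ A, (α i : ℚ)) ^ ((#A : ℤ) - 2) *
        ((a - c : ℕ) + ∑ i ∈ R \ A, (α i : ℚ)) ^ ((#(R \ A) : ℤ) - 2) =
      powSelfDivFactorial c * powSelfDivFactorial (a - c) / (c * (a - c : ℕ)) * a *
        K ^ ((#R : ℤ) - 1) -
      (∑ s ∈ R, α s * (powSelfDivFactorial c * powSelfDivFactorial (a - c) / (a - c : ℕ) +
          powSelfDivFactorial (a - c) * powSelfDivFactorial c / c +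
          powSelfDivFactorial c * powSelfDivFactorial (a - c) / (c + α s) +
          powSelfDivFactorial (a - c) * powSelfDivFactorial c / ((a - c : ℕ) + α s))) *
        K ^ ((#R : ℤ) - 2) +
      (∑ s ∈ R, ∑ t ∈ R.erase s, α s * α t *
        (powSelfDivFactorial c * powSelfDivFactorial (a - c) / (c + α s) +
          powSelfDivFactorial (a - c) * powSelfDivFactorial c / ((a - c : ℕ) + α t))) *
        K ^ ((#R : ℤ) - 3) := by
    intro c hc
    obtain ⟨h3, h4⟩ := mem_Ico.1 hc
    obtain ⟨d, rfl⟩ : ∃ d, a = c + d := ⟨a - c, by omega⟩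
    have hd : 0 < d := by omega
    rw [Nat.add_sub_cancel_left]
    have hc' : (0 : ℚ) < c := by exact_mod_cast h3
    have hd' : (0 : ℚ) < d := by exact_mod_cast hd
    have h := hurwitz_abel_sub_two (fun i => (α i : ℚ)) (fun i => Nat.cast_nonneg _) c d hc' hd'
      R K (by rw [hK]; push_cast; ring)
    rw [hurwitzWeight_eq h3, hurwitzWeight_eq hd]
    have e0 : (c : ℚ) * powSelfDivFactorial c * (d * powSelfDivFactorial d) *
      ∑ A ∈ R.powerset, (c + ∑ i ∈ A, (α i : ℚ)) ^ ((#A : ℤ) - 2) *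
        (d + ∑ i ∈ R \ A, (α i : ℚ)) ^ ((#(R \ A) : ℤ) - 2) =
      powSelfDivFactorial c * powSelfDivFactorial d / (c * d) *
      ∑ A ∈ R.powerset, (c ^ 2 * (c + ∑ i ∈ A, (α i : ℚ)) ^ ((#A : ℤ) - 2)) *
        (d ^ 2 * (d + ∑ i ∈ R \ A, (α i : ℚ)) ^ ((#(R \ A) : ℤ) - 2)) := by
      rw [mul_sum, mul_sum]
      refine sum_congr rfl fun A _ => ?_
      field_simp
    rw [e0, h, mul_add, mul_sub, ← mul_assoc, ← mul_assoc, ← mul_assoc, mul_sum, mul_sum]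
    congr 1
    · congr 1
      · push_cast; ring
      · congr 1
        refine sum_congr rfl fun s _ => ?_
        have h5 : (0 : ℚ) < c + α s := by positivity
        have h6 : (0 : ℚ) < d + α s := by positivity
        field_simp
        ring
    · congr 1
      refine sum_congr rfl fun s _ => ?_
      rw [mul_sum]
      refine sum_congr rfl fun t _ => ?_
      have h5 : (0 : ℚ) < c + α s := by positivity
      have h6 : (0 : ℚ) < d + α t := by positivity
      field_simp
      ring
  rw [sum_congr rfl h1, sum_add_distrib, sum_sub_distrib, ← sum_mul, ← sum_mul, ← sum_mul,
    ← sum_mul, sum_powSelfDivFactorial_mul_div_mul a ha, sum_comm]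
  have hY := sum_powSelfDivFactorial_mul_div a ha
  have hY' : ∑ c ∈ Ico 1 a, powSelfDivFactorial (a - c) * powSelfDivFactorial c / c =
      powSelfDivFactorial a * (1 - 1 / a) := by
    rw [← hY, sum_Ico_reflect_sub a (fun c d => powSelfDivFactorial c * powSelfDivFactorial d / d)]
  have hX : ∀ s : ℕ, ∑ c ∈ Ico 1 a, powSelfDivFactorial (a - c) * powSelfDivFactorial c /
      ((a - c : ℕ) + s) = cutSum a s := by
    intro s
    rw [cutSum, ← sum_Ico_reflect_sub a
      (fun c d => powSelfDivFactorial c * powSelfDivFactorial d / (c + s))]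
  have h2 : ∀ s ∈ R, ∑ c ∈ Ico 1 a, (α s : ℚ) *
      (powSelfDivFactorial c * powSelfDivFactorial (a - c) / (a - c : ℕ) +
          powSelfDivFactorial (a - c) * powSelfDivFactorial c / c +
          powSelfDivFactorial c * powSelfDivFactorial (a - c) / (c + α s) +
          powSelfDivFactorial (a - c) * powSelfDivFactorial c / ((a - c : ℕ) + α s)) =
      2 * (powSelfDivFactorial a * (1 - 1 / a)) * α s + 2 * (α s * cutSum a (α s)) := by
    intro s _
    rw [← mul_sum, sum_add_distrib, sum_add_distrib, sum_add_distrib, hY, hY', hX, ← cutSum]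
    ring
  have h3 : ∑ c ∈ Ico 1 a, ∑ s ∈ R, ∑ t ∈ R.erase s, (α s : ℚ) * α t *
        (powSelfDivFactorial c * powSelfDivFactorial (a - c) / (c + α s) +
          powSelfDivFactorial (a - c) * powSelfDivFactorial c / ((a - c : ℕ) + α t)) =
      2 * ∑ s ∈ R, α s * cutSum a (α s) * (K - a - α s) := by
    rw [sum_comm]
    have h4 : ∀ s ∈ R, ∑ c ∈ Ico 1 a, ∑ t ∈ R.erase s, (α s : ℚ) * α t *
        (powSelfDivFactorial c * powSelfDivFactorial (a - c) / (c + α s) +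
          powSelfDivFactorial (a - c) * powSelfDivFactorial c / ((a - c : ℕ) + α t)) =
        ∑ t ∈ R.erase s, α s * α t * cutSum a (α s) +
        ∑ t ∈ R.erase s, α s * α t * cutSum a (α t) := by
      intro s _
      rw [sum_comm, ← sum_add_distrib]
      refine sum_congr rfl fun t _ => ?_
      rw [← mul_sum, sum_add_distrib, hX, ← cutSum]
      ring
    have h5 : ∑ s ∈ R, ∑ t ∈ R.erase s, (α s : ℚ) * α t * cutSum a (α t) =
        ∑ s ∈ R, ∑ t ∈ R.erase s, (α s : ℚ) * α t * cutSum a (α s) := by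
      rw [sum_comm' (t' := R) (s' := fun s => R.erase s)
        (by intro x y; simp only [mem_erase]; tauto)]
      exact sum_congr rfl fun s _ => sum_congr rfl fun t _ => by ring
    rw [sum_congr rfl h4, sum_add_distrib, h5, ← two_mul]
    congr 1
    refine sum_congr rfl fun s hs => ?_
    have : ∑ t ∈ R.erase s, (α t : ℚ) = K - a - α s := by
      rw [hK, ← add_sum_erase _ _ hs]; ring
    rw [← this, mul_sum]
    exact sum_congr rfl fun t _ => by ring
  have hZ : ∑ s ∈ R, (α s : ℚ) = K - a := by rw [hK]; ring
  rw [sum_congr rfl h2, h3, sum_add_distrib, ← mul_sum, ← mul_sum, hZ]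
  have h6 : ∑ s ∈ R, α s * cutSum a (α s) * (K - a - α s) =
      K * (∑ s ∈ R, α s * cutSum a (α s)) - ∑ s ∈ R, α s * (a + α s) * cutSum a (α s) := by
    rw [mul_sum, ← sum_sub_distrib]
    exact sum_congr rfl fun s _ => by ring
  have z2 : K ^ ((#R : ℤ) - 2) = K ^ ((#R : ℤ) - 3) * K := by
    rw [← zpow_add_one₀ hKpos.ne']; congr 1; ring
  have z1 : K ^ ((#R : ℤ) - 1) = K ^ ((#R : ℤ) - 3) * K * K := by
    rw [← z2, ← zpow_add_one₀ hKpos.ne']; congr 1; ring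
  rw [h6, z1, z2]
  have ha' : (a : ℚ) ≠ 0 := by positivity
  field_simp
  ring

/-- The cut-and-join identity satisfied by Hurwitz's closed formula. -/
lemma hurwitz_cut_join_identity {ι : Type*} [DecidableEq ι] (α : ι → ℕ) (S : Finset ι)
    (hS : S.Nonempty) (hα : ∀ i ∈ S, 0 < α i) (K : ℚ) (hK : K = ∑ i ∈ S, (α i : ℚ)) :
    ∑ i ∈ S, (α i : ℚ) * (∑ j ∈ S.erase i, (α j : ℚ) * (hurwitzWeight (α i + α j) /
        (hurwitzWeight (α i) * hurwitzWeight (α j)) * K ^ ((#S : ℤ) - 4)) +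
      ∑ c ∈ Ico 1 (α i), hurwitzWeight c * hurwitzWeight (α i - c) / hurwitzWeight (α i) *
        ∑ A ∈ (S.erase i).powerset, (c + ∑ i ∈ A, (α i : ℚ)) ^ ((#A : ℤ) - 2) *
          ((α i - c : ℕ) + ∑ i ∈ S.erase i \ A, (α i : ℚ)) ^ ((#(S.erase i \ A) : ℤ) - 2)) =
    2 * (K + #S - 2) * K ^ ((#S : ℤ) - 3) := by
  have hKpos : 0 < K := by
    rw [hK]
    exact sum_pos (fun i hi => by exact_mod_cast hα i hi) hS
  have z : K ^ ((#S : ℤ) - 3) = K ^ ((#S : ℤ) - 4) * K := by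
    rw [← zpow_add_one₀ hKpos.ne']; congr 1; ring
  have h1 : ∀ i ∈ S, (α i : ℚ) * (∑ j ∈ S.erase i, (α j : ℚ) * (hurwitzWeight (α i + α j) /
        (hurwitzWeight (α i) * hurwitzWeight (α j)) * K ^ ((#S : ℤ) - 4)) +
      ∑ c ∈ Ico 1 (α i), hurwitzWeight c * hurwitzWeight (α i - c) / hurwitzWeight (α i) *
        ∑ A ∈ (S.erase i).powerset, (c + ∑ i ∈ A, (α i : ℚ)) ^ ((#A : ℤ) - 2) *
          ((α i - c : ℕ) + ∑ i ∈ S.erase i \ A, (α i : ℚ)) ^ ((#(S.erase i \ A) : ℤ) - 2)) =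
      2 * ((α i : ℚ) - 1) * K ^ ((#S : ℤ) - 3) +
      (∑ j ∈ S.erase i, (α i * α j * hurwitzWeight (α i + α j) /
          (hurwitzWeight (α i) * hurwitzWeight (α j)) -
        α j * (α i + α j) * cutSum (α i) (α j) / powSelfDivFactorial (α i) -
        α j * (α i + α j) * cutSum (α i) (α j) / powSelfDivFactorial (α i))) *
          K ^ ((#S : ℤ) - 4) := by
    intro i hi
    have hc := sum_hurwitzWeight_cut α (α i) (hα i hi) (S.erase i) K
      (by rw [hK, ← add_sum_erase _ _ hi])
    have hcard : ((#(S.erase i) : ℕ) : ℤ) = #S - 1 := by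
      have := card_erase_add_one hi
      omega
    have e2 : ((#(S.erase i) : ℕ) : ℤ) - 2 = #S - 3 := by omega
    have e3 : ((#(S.erase i) : ℕ) : ℤ) - 3 = #S - 4 := by omega
    rw [e2, e3] at hc
    have hw := (hurwitzWeight_pos (hα i hi)).ne'
    have he := (powSelfDivFactorial_pos (hα i hi)).ne'
    have ha : (α i : ℚ) ≠ 0 := by have := hα i hi; positivity
    simp_rw [div_mul_eq_mul_div, ← sum_div]
    rw [hc, mul_add, hurwitzWeight_eq (hα i hi)]
    rw [sum_sub_distrib, sum_sub_distrib, ← sum_div, mul_sum]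
    have e4 : ∀ j ∈ S.erase i, (α i : ℚ) * (α j * (hurwitzWeight (α i + α j) *
        K ^ ((#S : ℤ) - 4) / (α i * powSelfDivFactorial (α i) * hurwitzWeight (α j)))) =
        α i * α j * hurwitzWeight (α i + α j) /
          (α i * powSelfDivFactorial (α i) * hurwitzWeight (α j)) * K ^ ((#S : ℤ) - 4) := by
      intro j _
      ring
    rw [sum_congr rfl e4, ← sum_mul]
    field_simp
    ring
  have h2 : ∑ i ∈ S, ∑ j ∈ S.erase i,
      (α j : ℚ) * (α i + α j) * cutSum (α i) (α j) / powSelfDivFactorial (α i) =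
      ∑ i ∈ S, ∑ j ∈ S.erase i,
      (α i : ℚ) * (α j + α i) * cutSum (α j) (α i) / powSelfDivFactorial (α j) :=
    sum_comm' (by intro x y; simp only [mem_erase]; tauto)
  have h3 : ∀ i ∈ S, ∀ j ∈ S.erase i, α i * α j * hurwitzWeight (α i + α j) /
          (hurwitzWeight (α i) * hurwitzWeight (α j)) -
        (α j : ℚ) * (α i + α j) * cutSum (α i) (α j) / powSelfDivFactorial (α i) -
        α i * (α j + α i) * cutSum (α j) (α i) / powSelfDivFactorial (α j) =
        2 * (α i + α j) := by
    intro i hi j hj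
    have hj := hα j (mem_of_mem_erase hj)
    have hi := hα i hi
    have h := two_mul_powSelfDivFactorial_mul (α i) (α j) hi hj
    rw [← cutSum, ← cutSum] at h
    rw [hurwitzWeight_eq hi, hurwitzWeight_eq hj, hurwitzWeight_eq (Nat.add_pos_left hi _)]
    have hei := (powSelfDivFactorial_pos hi).ne'
    have hej := (powSelfDivFactorial_pos hj).ne'
    have hi' : (α i : ℚ) ≠ 0 := by positivity
    have hj' : (α j : ℚ) ≠ 0 := by positivity
    push_cast
    field_simp
    linear_combination (-(α i + α j : ℚ)) * h
  rw [sum_congr rfl h1, sum_add_distrib, ← sum_mul, ← sum_mul]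
  simp_rw [sum_sub_distrib]
  nth_rewrite 2 [h2]
  have h4 : ∑ i ∈ S, ∑ j ∈ S.erase i, ((α i : ℚ) * α j * hurwitzWeight (α i + α j) /
          (hurwitzWeight (α i) * hurwitzWeight (α j))) -
      ∑ i ∈ S, ∑ j ∈ S.erase i,
        (α j : ℚ) * (α i + α j) * cutSum (α i) (α j) / powSelfDivFactorial (α i) -
      ∑ i ∈ S, ∑ j ∈ S.erase i,
        (α i : ℚ) * (α j + α i) * cutSum (α j) (α i) / powSelfDivFactorial (α j) =
      4 * (#S - 1) * K := by
    rw [← sum_sub_distrib, ← sum_sub_distrib]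
    simp_rw [← sum_sub_distrib]
    rw [sum_congr rfl fun i hi => sum_congr rfl (h3 i hi)]
    have h5 : ∀ i ∈ S, ∑ j ∈ S.erase i, 2 * ((α i : ℚ) + α j) =
        2 * ((#S - 1) * α i + (K - α i)) := by
      intro i hi
      rw [← mul_sum, sum_add_distrib, sum_const, nsmul_eq_mul, card_erase_of_mem hi,
        Nat.cast_sub (card_pos.2 hS), hK, ← add_sum_erase _ _ hi]
      push_cast
      ring
    rw [sum_congr rfl h5, ← mul_sum, sum_add_distrib, sum_sub_distrib, ← mul_sum, ← hK, sum_const,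
      nsmul_eq_mul]
    ring
  rw [h4, z]
  have h6 : ∑ i ∈ S, 2 * ((α i : ℚ) - 1) = 2 * (K - #S) := by
    rw [← mul_sum, sum_sub_distrib, ← hK, sum_const, nsmul_eq_mul, mul_one]
  rw [h6]
  ring

section SetoidClasses

variable {V : Type*}

namespace Setoid

/-- The setoid obtained from `s` by merging the classes of `a` and `b`. -/
def glue (s : Setoid V) (a b : V) : Setoid V where
  r x y := s x y ∨ (s x a ∧ s y b) ∨ (s x b ∧ s y a)
  iseqv := by
    refine ⟨fun x => Or.inl (s.refl x), fun {x y} h => ?_, fun {x y z} h h' => ?_⟩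
    · rcases h with h | h | h
      · exact Or.inl (s.symm h)
      · exact Or.inr (Or.inr h.symm)
      · exact Or.inr (Or.inl h.symm)
    · rcases h with h | h | h <;> rcases h' with h' | h' | h'
      · exact Or.inl (s.trans h h')
      · exact Or.inr (Or.inl ⟨s.trans h h'.1, h'.2⟩)
      · exact Or.inr (Or.inr ⟨s.trans h h'.1, h'.2⟩)
      · exact Or.inr (Or.inl ⟨h.1, s.trans (s.symm h') h.2⟩)
      · exact Or.inr (Or.inl ⟨h.1, h'.2⟩)
      · exact Or.inl (s.trans h.1 (s.symm h'.2))
      · exact Or.inr (Or.inr ⟨h.1, s.trans (s.symm h') h.2⟩)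
      · exact Or.inl (s.trans h.1 (s.symm h'.2))
      · exact Or.inr (Or.inr ⟨h.1, h'.2⟩)

lemma glue_apply {s : Setoid V} {a b x y : V} :
    s.glue a b x y ↔ s x y ∨ (s x a ∧ s y b) ∨ (s x b ∧ s y a) := Iff.rfl

lemma glue_le_iff {s p : Setoid V} {a b : V} : s.glue a b ≤ p ↔ s ≤ p ∧ p a b := by
  constructor
  · exact fun h => ⟨fun x y hxy => h (Or.inl hxy), h (Or.inr (Or.inl ⟨s.refl a, s.refl b⟩))⟩
  · rintro ⟨h, hab⟩ x y (hxy | ⟨hx, hy⟩ | ⟨hx, hy⟩)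
    · exact h hxy
    · exact p.trans (h hx) (p.trans hab (p.symm (h hy)))
    · exact p.trans (h hx) (p.trans (p.symm hab) (p.symm (h hy)))

lemma le_glue (s : Setoid V) (a b : V) : s ≤ s.glue a b := (glue_le_iff.1 le_rfl).1

lemma glue_rel (s : Setoid V) (a b : V) : s.glue a b a b := (glue_le_iff.1 le_rfl).2

lemma glue_eq_self {s : Setoid V} {a b : V} (h : s a b) : s.glue a b = s :=
  le_antisymm (glue_le_iff.2 ⟨le_rfl, h⟩) (s.le_glue a b)

variable [Fintype V] [DecidableEq V]

open Classical in
/-- The equivalence class of `x`, as a finset. -/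
noncomputable def cls (s : Setoid V) (x : V) : Finset V := {y | s x y}

/-- The equivalence classes of `s`, as a finset of finsets. -/
noncomputable def blk (s : Setoid V) : Finset (Finset V) := univ.image s.cls

/-- The equivalence classes of `s` contained in `B`. -/
noncomputable def blkIn (s : Setoid V) (B : Finset V) : Finset (Finset V) := {C ∈ s.blk | C ⊆ B}

omit [DecidableEq V] in
lemma mem_cls {s : Setoid V} {x y : V} : y ∈ s.cls x ↔ s x y := by simp [cls]

omit [DecidableEq V] in
lemma self_mem_cls (s : Setoid V) (x : V) : x ∈ s.cls x := mem_cls.2 (s.refl x)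

lemma cls_mem_blk (s : Setoid V) (x : V) : s.cls x ∈ s.blk := mem_image_of_mem _ (mem_univ x)

omit [DecidableEq V] in
lemma cls_eq_iff {s : Setoid V} {x y : V} : s.cls x = s.cls y ↔ s x y := by
  constructor
  · intro h
    exact mem_cls.1 (h ▸ s.self_mem_cls y)
  · intro h
    ext z
    rw [mem_cls, mem_cls]
    exact ⟨s.trans (s.symm h), s.trans h⟩

lemma eq_cls_of_mem {s : Setoid V} {C : Finset V} {x : V} (hC : C ∈ s.blk) (hx : x ∈ C) :
    C = s.cls x := by
  obtain ⟨y, -, rfl⟩ := mem_image.1 hC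
  exact cls_eq_iff.2 (mem_cls.1 hx)

lemma nonempty_of_mem_blk {s : Setoid V} {C : Finset V} (hC : C ∈ s.blk) : C.Nonempty := by
  obtain ⟨y, -, rfl⟩ := mem_image.1 hC
  exact ⟨y, s.self_mem_cls y⟩

lemma card_pos_of_mem_blk {s : Setoid V} {C : Finset V} (hC : C ∈ s.blk) : 0 < #C :=
  card_pos.2 (nonempty_of_mem_blk hC)

lemma disjoint_of_mem_blk {s : Setoid V} {C D : Finset V} (hC : C ∈ s.blk) (hD : D ∈ s.blk)
    (h : C ≠ D) : Disjoint C D := by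
  rw [disjoint_left]
  intro x hx hx'
  exact h ((eq_cls_of_mem hC hx).trans (eq_cls_of_mem hD hx').symm)

lemma mem_blkIn {s : Setoid V} {B C : Finset V} : C ∈ s.blkIn B ↔ C ∈ s.blk ∧ C ⊆ B := by
  simp [blkIn]

omit [DecidableEq V] in
lemma cls_subset_cls {s p : Setoid V} (h : s ≤ p) (x : V) : s.cls x ⊆ p.cls x :=
  fun _ hy => mem_cls.2 (h (mem_cls.1 hy))

lemma cls_subset_iff {s p : Setoid V} (h : s ≤ p) {x : V} {B : Finset V} (hB : B ∈ p.blk) :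
    s.cls x ⊆ B ↔ x ∈ B := by
  constructor
  · exact fun h => h (s.self_mem_cls x)
  · intro hx
    rw [eq_cls_of_mem hB hx]
    exact cls_subset_cls h x

/-- A sum over the elements lying in given classes, grouped by classes. -/
lemma sum_cls_mem (s : Setoid V) {𝒯 : Finset (Finset V)} (h𝒯 : 𝒯 ⊆ s.blk) {M : Type*}
    [AddCommMonoid M] (f : Finset V → M) :
    ∑ x with s.cls x ∈ 𝒯, f (s.cls x) = ∑ C ∈ 𝒯, #C • f C := by
  rw [← sum_fiberwise_of_maps_to (s := {x | s.cls x ∈ 𝒯}) (t := 𝒯) (g := s.cls)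
    (fun x hx => (mem_filter.1 hx).2)]
  refine sum_congr rfl fun C hC => ?_
  rw [sum_congr rfl (g := fun _ => f C), sum_const]
  · congr 2
    ext x
    simp only [mem_filter, mem_univ, true_and]
    constructor
    · rintro ⟨-, rfl⟩
      exact s.self_mem_cls x
    · intro hx
      have := eq_cls_of_mem (h𝒯 hC) hx
      exact ⟨this ▸ hC, this.symm⟩
  · intro x hx
    rw [(mem_filter.1 hx).2]

lemma blkIn_subset (s : Setoid V) (B : Finset V) : s.blkIn B ⊆ s.blk := filter_subset _ _

lemma sum_mem_block {s p : Setoid V} (h : s ≤ p) {B : Finset V} (hB : B ∈ p.blk) {M : Type*}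
    [AddCommMonoid M] (f : Finset V → M) :
    ∑ x ∈ B, f (s.cls x) = ∑ C ∈ s.blkIn B, #C • f C := by
  rw [← sum_cls_mem s (s.blkIn_subset B)]
  refine sum_congr ?_ fun _ _ => rfl
  ext x
  simp [mem_blkIn, cls_mem_blk, cls_subset_iff h hB]

lemma sum_mem_block_sdiff {s p : Setoid V} (h : s ≤ p) {B : Finset V} (hB : B ∈ p.blk) (a : V)
    {M : Type*} [AddCommMonoid M] (f : Finset V → M) :
    ∑ x ∈ B \ s.cls a, f (s.cls x) = ∑ C ∈ (s.blkIn B).erase (s.cls a), #C • f C := by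
  rw [← sum_cls_mem s ((erase_subset _ _).trans (s.blkIn_subset B))]
  refine sum_congr ?_ fun _ _ => rfl
  ext x
  simp only [mem_sdiff, mem_filter, mem_univ, true_and, mem_erase, ne_eq, cls_eq_iff, mem_blkIn,
    cls_mem_blk, cls_subset_iff h hB, mem_cls]
  rw [and_comm, Setoid.comm' s]

lemma sum_card_blkIn {s p : Setoid V} (h : s ≤ p) {B : Finset V} (hB : B ∈ p.blk) :
    ∑ C ∈ s.blkIn B, #C = #B := by
  have := sum_mem_block h hB (fun _ => 1)
  simpa using this.symm

lemma sum_univ_eq_sum_blk (s : Setoid V) {M : Type*} [AddCommMonoid M] (f : V → M) :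
    ∑ x, f x = ∑ C ∈ s.blk, ∑ x ∈ C, f x := by
  rw [← sum_fiberwise_of_maps_to (s := univ) (t := s.blk) (g := s.cls)
    (fun x _ => s.cls_mem_blk x)]
  refine sum_congr rfl fun C hC => sum_congr ?_ fun _ _ => rfl
  ext x
  simp only [mem_filter, mem_univ, true_and]
  exact ⟨fun h => h ▸ s.self_mem_cls x, fun h => (eq_cls_of_mem hC h).symm⟩

lemma sum_card_blk (s : Setoid V) : ∑ C ∈ s.blk, #C = Fintype.card V := by
  rw [← card_univ, card_eq_sum_ones, s.sum_univ_eq_sum_blk]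
  simp only [sum_const, smul_eq_mul, mul_one]

lemma blk_eq_biUnion {s p : Setoid V} (h : s ≤ p) : s.blk = p.blk.biUnion s.blkIn := by
  ext C
  simp only [mem_biUnion, mem_blkIn]
  constructor
  · intro hC
    obtain ⟨x, hx⟩ := nonempty_of_mem_blk hC
    refine ⟨p.cls x, p.cls_mem_blk x, hC, ?_⟩
    rw [eq_cls_of_mem hC hx]
    exact cls_subset_cls h x
  · exact fun ⟨_, _, hC, _⟩ => hC

lemma sum_card_blkIn_blk {s p : Setoid V} (h : s ≤ p) : ∑ B ∈ p.blk, #(s.blkIn B) = #s.blk := by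
  rw [blk_eq_biUnion h, card_biUnion]
  intro B hB B' hB' hne
  rw [Function.onFun, disjoint_left]
  intro C hC hC'
  rw [mem_blkIn] at hC hC'
  obtain ⟨x, hx⟩ := nonempty_of_mem_blk hC.1
  exact disjoint_left.1 (disjoint_of_mem_blk hB hB' hne) (hC.2 hx) (hC'.2 hx)

lemma card_blk_le_of_le {s p : Setoid V} (h : s ≤ p) : #p.blk ≤ #s.blk := by
  rw [← sum_card_blkIn_blk h, card_eq_sum_ones]
  refine sum_le_sum fun B hB => card_pos.2 ?_
  obtain ⟨x, hx⟩ := nonempty_of_mem_blk hB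
  exact ⟨s.cls x, mem_blkIn.2 ⟨s.cls_mem_blk x, (cls_subset_iff h hB).2 hx⟩⟩

lemma card_blk_le (s : Setoid V) : #s.blk ≤ Fintype.card V := by
  rw [← s.sum_card_blk, card_eq_sum_ones]
  exact sum_le_sum fun C hC => card_pos_of_mem_blk hC

lemma eq_bot_of_card_le_card_blk {s : Setoid V} (h : Fintype.card V ≤ #s.blk) : s = ⊥ := by
  have hinj : Function.Injective s.cls := by
    rw [← Set.injOn_univ, ← coe_univ]
    refine injOn_of_card_image_eq (le_antisymm card_image_le ?_)
    rwa [card_univ]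
  rw [eq_bot_iff]
  intro x y hxy
  exact hinj (cls_eq_iff.2 hxy)

omit [DecidableEq V] in
lemma cls_glue_of_not_rel {s : Setoid V} {a b x : V} (ha : ¬ s x a) (hb : ¬ s x b) :
    (s.glue a b).cls x = s.cls x := by
  ext y
  simp [mem_cls, glue_apply, ha, hb]

lemma cls_glue_left (s : Setoid V) (a b : V) : (s.glue a b).cls a = s.cls a ∪ s.cls b := by
  ext y
  simp only [mem_cls, glue_apply, mem_union]
  constructor
  · rintro (h | ⟨-, h⟩ | ⟨h, h'⟩)
    · exact Or.inl h
    · exact Or.inr (s.symm h)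
    · exact Or.inl (s.symm h')
  · rintro (h | h)
    · exact Or.inl h
    · exact Or.inr (Or.inl ⟨s.refl a, s.symm h⟩)

lemma blk_glue (s : Setoid V) (a b : V) :
    (s.glue a b).blk =
      insert (s.cls a ∪ s.cls b) ((s.blk.erase (s.cls a)).erase (s.cls b)) := by
  ext C
  simp only [mem_insert, mem_erase]
  constructor
  · intro hC
    obtain ⟨x, hx⟩ := nonempty_of_mem_blk hC
    have hCx := eq_cls_of_mem hC hx
    by_cases ha : s.glue a b a x
    · left
      rw [hCx, ← cls_glue_left, cls_eq_iff]
      exact (s.glue a b).symm ha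
    · right
      have ha' : ¬ s x a := fun h => ha ((s.le_glue a b) (s.symm h))
      have hb' : ¬ s x b := fun h =>
        ha ((s.glue a b).trans (s.glue_rel a b) ((s.le_glue a b) (s.symm h)))
      rw [hCx, cls_glue_of_not_rel ha' hb']
      exact ⟨mt cls_eq_iff.1 hb', mt cls_eq_iff.1 ha', s.cls_mem_blk x⟩
  · rintro (rfl | ⟨hb, ha, hC⟩)
    · rw [← cls_glue_left]
      exact cls_mem_blk _ _
    · obtain ⟨x, hx⟩ := nonempty_of_mem_blk hC
      have hCx := eq_cls_of_mem hC hx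
      subst hCx
      rw [← cls_glue_of_not_rel (mt cls_eq_iff.2 ha) (mt cls_eq_iff.2 hb)]
      exact cls_mem_blk _ _

lemma union_cls_notMem_blk {s : Setoid V} {a b : V} (hab : ¬ s a b) :
    s.cls a ∪ s.cls b ∉ s.blk := by
  intro h
  have h1 := eq_cls_of_mem h (mem_union_left _ (s.self_mem_cls a))
  have h2 := eq_cls_of_mem h (mem_union_right _ (s.self_mem_cls b))
  exact hab (cls_eq_iff.1 (h1.symm.trans h2))

lemma prod_blk_glue {s : Setoid V} {a b : V} (hab : ¬ s a b) {M : Type*} [CommMonoid M]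
    (f : Finset V → M) :
    (∏ C ∈ (s.glue a b).blk, f C) * (f (s.cls a) * f (s.cls b)) =
      (∏ C ∈ s.blk, f C) * f (s.cls a ∪ s.cls b) := by
  rw [blk_glue, prod_insert, ← mul_prod_erase s.blk f (s.cls_mem_blk a),
    ← mul_prod_erase (s.blk.erase (s.cls a)) f (a := s.cls b)]
  · ac_rfl
  · exact mem_erase.2 ⟨fun h => hab (s.symm (cls_eq_iff.1 h)), s.cls_mem_blk b⟩
  · exact fun h => union_cls_notMem_blk hab (mem_of_mem_erase (mem_of_mem_erase h))

lemma card_blk_glue {s : Setoid V} {a b : V} (hab : ¬ s a b) :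
    #(s.glue a b).blk + 1 = #s.blk := by
  have hb : s.cls b ∈ s.blk.erase (s.cls a) :=
    mem_erase.2 ⟨fun h => hab (s.symm (cls_eq_iff.1 h)), s.cls_mem_blk b⟩
  rw [blk_glue, card_insert_of_notMem, ← card_erase_add_one (s.cls_mem_blk a),
    ← card_erase_add_one hb]
  exact fun h => union_cls_notMem_blk hab (mem_of_mem_erase (mem_of_mem_erase h))

end Setoid

end SetoidClasses

section CutJoin

variable {V : Type*}

/-- The setoid whose classes are the cycles of `π`, fixed points included. -/
abbrev cyc (π : Equiv.Perm V) : Setoid V := Equiv.Perm.SameCycle.setoid π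

lemma cyc_le_iff {π : Equiv.Perm V} {s : Setoid V} : cyc π ≤ s ↔ ∀ x, s x (π x) := by
  constructor
  · exact fun h x => h ⟨1, by simp⟩
  · intro h x y hxy
    have hpow : ∀ n : ℕ, ∀ x, s x ((π ^ n) x) := by
      intro n
      induction n with
      | zero => exact fun x => s.refl x
      | succ n ih =>
        intro x
        rw [pow_succ', Equiv.Perm.mul_apply]
        exact s.trans (ih x) (h _)
    obtain ⟨i, rfl⟩ := hxy
    obtain ⟨n, rfl | rfl⟩ := i.eq_nat_or_neg
    · exact hpow n x
    · have := hpow n ((π ^ (-(n : ℤ))) x)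
      rw [zpow_neg, zpow_natCast, ← Equiv.Perm.mul_apply, mul_inv_cancel,
        Equiv.Perm.one_apply] at this
      rw [zpow_neg, zpow_natCast]
      exact s.symm this

lemma cyc_iterate (π : Equiv.Perm V) (a : V) (n : ℕ) : cyc π a (π^[n] a) :=
  ⟨n, by rw [zpow_natCast, Equiv.Perm.iterate_eq_pow]⟩

lemma iterate_ne_of_lt_minimalPeriod {π : Equiv.Perm V} {a : V} {j : ℕ}
    (hj : j < Function.minimalPeriod π a) :
    ∀ i, 0 < i → i < j → π^[i] a ≠ a ∧ π^[i] a ≠ π^[j] a := by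
  intro i hi hij
  refine ⟨fun h =>
    Function.not_isPeriodicPt_of_pos_of_lt_minimalPeriod hi.ne' (hij.trans hj) h, fun h => ?_⟩
  exact hij.ne (Function.iterate_injOn_Iio_minimalPeriod (hij.trans hj) hj h)

variable [DecidableEq V]

lemma cyc_swap_mul_le (π : Equiv.Perm V) (a b : V) :
    cyc (Equiv.swap a b * π) ≤ (cyc π).glue a b := by
  rw [cyc_le_iff]
  intro x
  have hx : cyc π x (π x) := ⟨1, by simp⟩
  rw [Equiv.Perm.mul_apply]
  by_cases ha : π x = a
  · rw [ha, Equiv.swap_apply_left]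
    exact Or.inr (Or.inl ⟨ha ▸ hx, (cyc π).refl b⟩)
  by_cases hb : π x = b
  · rw [hb, Equiv.swap_apply_right]
    exact Or.inr (Or.inr ⟨hb ▸ hx, (cyc π).refl a⟩)
  rw [Equiv.swap_apply_of_ne_of_ne ha hb]
  exact Or.inl hx

lemma cyc_le_glue_swap_mul (π : Equiv.Perm V) (a b : V) :
    cyc π ≤ (cyc (Equiv.swap a b * π)).glue a b := by
  have := cyc_swap_mul_le (Equiv.swap a b * π) a b
  rwa [Equiv.swap_mul_self_mul] at this

lemma iterate_swap_mul {π : Equiv.Perm V} {a b : V} {n : ℕ}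
    (h : ∀ i, 0 < i → i < n → π^[i] a ≠ a ∧ π^[i] a ≠ b) {i : ℕ} (hi : i < n) :
    (Equiv.swap a b * π)^[i] a = π^[i] a := by
  induction i with
  | zero => rfl
  | succ i ih =>
    obtain ⟨h1, h2⟩ := h (i + 1) i.succ_pos hi
    rw [Function.iterate_succ_apply'] at h1 h2 ⊢
    rw [ih (by omega), Equiv.Perm.mul_apply, Equiv.swap_apply_of_ne_of_ne h1 h2,
      Function.iterate_succ_apply']

lemma iterate_swap_mul_last {π : Equiv.Perm V} {a b : V} {n : ℕ} (hn : 0 < n)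
    (h : ∀ i, 0 < i → i < n → π^[i] a ≠ a ∧ π^[i] a ≠ b) :
    (Equiv.swap a b * π)^[n] a = Equiv.swap a b (π^[n] a) := by
  obtain ⟨n, rfl⟩ := Nat.exists_eq_add_one.2 hn
  rw [Function.iterate_succ_apply', iterate_swap_mul h n.lt_succ_self, Equiv.Perm.mul_apply,
    Function.iterate_succ_apply']

variable [Fintype V]

omit [DecidableEq V] in
lemma minimalPeriod_perm_pos (π : Equiv.Perm V) (a : V) : 0 < Function.minimalPeriod π a :=
  Function.minimalPeriod_pos_of_mem_periodicPts
    (π.injective.mem_periodicPts a)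

lemma cls_cyc_eq_image (π : Equiv.Perm V) (a : V) :
    (cyc π).cls a = (range (Function.minimalPeriod π a)).image (fun i => π^[i] a) := by
  ext x
  simp only [Setoid.mem_cls, mem_image, mem_range]
  constructor
  · intro h
    obtain ⟨n, rfl⟩ := Equiv.Perm.SameCycle.exists_nat_pow_eq h
    refine ⟨n % Function.minimalPeriod π a, Nat.mod_lt _ (minimalPeriod_perm_pos π a), ?_⟩
    rw [Function.iterate_mod_minimalPeriod_eq, Equiv.Perm.iterate_eq_pow]
  · rintro ⟨i, -, rfl⟩
    exact cyc_iterate π a i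

lemma card_cls_cyc (π : Equiv.Perm V) (a : V) :
    #((cyc π).cls a) = Function.minimalPeriod π a := by
  rw [cls_cyc_eq_image, card_image_of_injOn, card_range]
  intro i hi j hj h
  exact Function.iterate_injOn_Iio_minimalPeriod (by simpa using hi) (by simpa using hj) h

/-- Multiplying by a transposition of elements in different cycles joins these cycles. -/
lemma cyc_swap_mul_of_not_rel {π : Equiv.Perm V} {a b : V} (hab : ¬ cyc π a b) :
    cyc (Equiv.swap a b * π) = (cyc π).glue a b := by
  refine le_antisymm (cyc_swap_mul_le π a b) ?_
  have h : cyc (Equiv.swap a b * π) a b := by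
    have h1 := cyc_iterate (Equiv.swap a b * π) a (Function.minimalPeriod π a)
    rwa [iterate_swap_mul_last (minimalPeriod_perm_pos π a), Function.iterate_minimalPeriod,
      Equiv.swap_apply_left] at h1
    intro i h0 hi
    refine ⟨fun h => Function.not_isPeriodicPt_of_pos_of_lt_minimalPeriod h0.ne' hi h, ?_⟩
    rintro rfl
    exact hab (cyc_iterate π a i)
  rw [Setoid.glue_le_iff]
  refine ⟨?_, h⟩
  have := cyc_le_glue_swap_mul π a b
  rwa [Setoid.glue_eq_self h] at this

lemma minimalPeriod_swap_mul {π : Equiv.Perm V} {a : V} {j : ℕ} (h0 : 0 < j)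
    (hj : j < Function.minimalPeriod π a) :
    Function.minimalPeriod (Equiv.swap a (π^[j] a) * π) a = j := by
  have h := iterate_ne_of_lt_minimalPeriod hj
  have hp : Function.IsPeriodicPt (Equiv.swap a (π^[j] a) * π) j a := by
    rw [Function.IsPeriodicPt, Function.IsFixedPt, iterate_swap_mul_last h0 h,
      Equiv.swap_apply_right]
  refine le_antisymm (hp.minimalPeriod_le h0) ?_
  by_contra! hlt
  have h1 := minimalPeriod_perm_pos (Equiv.swap a (π^[j] a) * π) a
  have h2 := iterate_swap_mul h hlt
  rw [Function.iterate_minimalPeriod] at h2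
  exact (h _ h1 hlt).1 h2.symm

/-- Multiplying by a transposition of elements in the same cycle cuts this cycle. -/
lemma not_cyc_swap_mul {π : Equiv.Perm V} {a b : V} (hne : a ≠ b) (hab : cyc π a b) :
    ¬ cyc (Equiv.swap a b * π) a b := by
  rw [← Setoid.mem_cls, cls_cyc_eq_image, mem_image] at hab
  obtain ⟨j, hj, rfl⟩ := hab
  rw [mem_range] at hj
  have h0 : 0 < j := Nat.pos_of_ne_zero (by rintro rfl; exact hne rfl)
  rw [← Setoid.mem_cls, cls_cyc_eq_image, minimalPeriod_swap_mul h0 hj, mem_image]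
  rintro ⟨i, hi, h⟩
  rw [mem_range] at hi
  rw [iterate_swap_mul (iterate_ne_of_lt_minimalPeriod hj) hi] at h
  exact hi.ne (Function.iterate_injOn_Iio_minimalPeriod (hi.trans hj) hj h)

lemma glue_cyc_swap_mul {π : Equiv.Perm V} {a b : V} (hne : a ≠ b) (hab : cyc π a b) :
    (cyc (Equiv.swap a b * π)).glue a b = cyc π := by
  rw [← cyc_swap_mul_of_not_rel (not_cyc_swap_mul hne hab), Equiv.swap_mul_self_mul]

/-- The sizes of the pieces into which a cycle is cut. -/
lemma sum_card_cls_swap_mul (π : Equiv.Perm V) (a : V) {M : Type*} [AddCommMonoid M] (f : ℕ → M) :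
    ∑ b ∈ ((cyc π).cls a).erase a, f #((cyc (Equiv.swap a b * π)).cls a) =
      ∑ j ∈ Ico 1 #((cyc π).cls a), f j := by
  symm
  refine sum_nbij (fun j => π^[j] a) ?_ ?_ ?_ ?_
  · intro j hj
    rw [card_cls_cyc, mem_Ico] at hj
    refine mem_erase.2 ⟨fun h => ?_, Setoid.mem_cls.2 (cyc_iterate π a j)⟩
    exact Function.not_isPeriodicPt_of_pos_of_lt_minimalPeriod (by omega) hj.2 h
  · intro i hi j hj h
    rw [card_cls_cyc, coe_Ico] at hi hj
    exact Function.iterate_injOn_Iio_minimalPeriod hi.2 hj.2 h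
  · intro b hb
    rw [mem_coe, mem_erase, cls_cyc_eq_image, mem_image] at hb
    obtain ⟨hne, j, hj, rfl⟩ := hb
    refine ⟨j, ?_, rfl⟩
    rw [card_cls_cyc, mem_coe, mem_Ico]
    refine ⟨Nat.pos_of_ne_zero ?_, mem_range.1 hj⟩
    rintro rfl
    exact hne rfl
  · intro j hj
    rw [card_cls_cyc, mem_Ico] at hj
    rw [card_cls_cyc, minimalPeriod_swap_mul hj.1 hj.2]

end CutJoin

section FactorCount

variable {V : Type*}

/-- The finest setoid whose classes are stable under all permutations `T i`. -/
def conn {r : ℕ} (T : Fin r → Equiv.Perm V) : Setoid V := sInf {s | ∀ i x, s x (T i x)}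

lemma conn_rel {r : ℕ} (T : Fin r → Equiv.Perm V) (i : Fin r) (x : V) : conn T x (T i x) :=
  fun _ hs => hs i x

lemma conn_le_iff {r : ℕ} {T : Fin r → Equiv.Perm V} {s : Setoid V} :
    conn T ≤ s ↔ ∀ i x, s x (T i x) :=
  ⟨fun h i x => h (conn_rel T i x), fun h => sInf_le h⟩

lemma conn_fin_zero (T : Fin 0 → Equiv.Perm V) : conn T = ⊥ :=
  le_bot_iff.1 (conn_le_iff.2 fun i => i.elim0)

lemma conn_cons_swap [DecidableEq V] {r : ℕ} (T : Fin r → Equiv.Perm V) (a b : V) :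
    conn (Fin.cons (Equiv.swap a b) T : Fin (r + 1) → Equiv.Perm V) = (conn T).glue a b := by
  refine eq_of_forall_ge_iff fun s => ?_
  rw [conn_le_iff, Fin.forall_fin_succ, Setoid.glue_le_iff, conn_le_iff, and_comm]
  simp only [Fin.cons_zero, Fin.cons_succ]
  refine and_congr_right fun _ => ⟨fun h => ?_, fun h x => ?_⟩
  · simpa using h a
  · by_cases ha : x = a
    · subst ha; simpa using h
    by_cases hb : x = b
    · subst hb; simpa using s.symm h
    rw [Equiv.swap_apply_of_ne_of_ne ha hb]

variable [Fintype V] [DecidableEq V]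

open Classical in
noncomputable instance : Fintype (Setoid V) :=
  Fintype.ofInjective (fun s : Setoid V => (fun x y => s x y : V → V → Prop))
    fun _ _ h => Setoid.ext fun x y => iff_of_eq (congrFun (congrFun h x) y)

open Classical in
/-- The number of factorizations of `π` into `r` transpositions with orbit partition `p`. -/
noncomputable def factorCount (r : ℕ) (π : Equiv.Perm V) (p : Setoid V) : ℕ :=
  #{T : Fin r → Equiv.Perm V | (∀ i, (T i).IsSwap) ∧ (List.ofFn T).prod = π ∧ conn T = p}

open Classical in
lemma factorCount_zero (π : Equiv.Perm V) (p : Setoid V) :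
    factorCount 0 π p = if π = 1 ∧ p = ⊥ then 1 else 0 := by
  rw [factorCount, card_filter, Fintype.sum_unique]
  simp [conn_fin_zero, eq_comm]

omit [Fintype V] in
lemma swap_eq_swap_iff {a b x y : V} (hab : a ≠ b) :
    Equiv.swap x y = Equiv.swap a b ↔ (x = a ∧ y = b) ∨ (x = b ∧ y = a) := by
  constructor
  · intro h
    have hxy : x ≠ y := by
      rintro rfl
      rw [Equiv.swap_self] at h
      exact hab (by simpa using congrArg (fun e => e a) h)
    have h1 : y = Equiv.swap a b x := by rw [← h, Equiv.swap_apply_left]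
    rw [Equiv.swap_apply_def] at h1
    split_ifs at h1 with h2 h3
    · exact Or.inl ⟨h2, h1⟩
    · exact Or.inr ⟨h3, h1⟩
    · exact absurd h1.symm hxy
  · rintro (⟨rfl, rfl⟩ | ⟨rfl, rfl⟩)
    · rfl
    · exact Equiv.swap_comm _ _

open Classical in
lemma sum_swap (f : Equiv.Perm V → ℕ) :
    ∑ a, ∑ b ∈ univ.erase a, f (Equiv.swap a b) = 2 * ∑ t with t.IsSwap, f t := by
  have h : ∑ a, ∑ b ∈ univ.erase a, f (Equiv.swap a b) =
      ∑ p : V × V with p.1 ≠ p.2, f (Equiv.swap p.1 p.2) := by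
    rw [sum_filter, Fintype.sum_prod_type]
    refine sum_congr rfl fun a _ => ?_
    rw [← sum_filter]
    refine sum_congr ?_ fun _ _ => rfl
    ext b
    simp [eq_comm]
  rw [h, ← sum_fiberwise_of_maps_to (t := ({t : Equiv.Perm V | t.IsSwap} : Finset _))
    (g := fun p : V × V => Equiv.swap p.1 p.2), mul_sum]
  · refine sum_congr rfl fun t ht => ?_
    obtain ⟨a, b, hab, rfl⟩ := (mem_filter.1 ht).2
    have h2 : ({p ∈ ({p : V × V | p.1 ≠ p.2} : Finset _) |
        Equiv.swap p.1 p.2 = Equiv.swap a b} : Finset (V × V)) = {(a, b), (b, a)} := by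
      ext ⟨x, y⟩
      simp only [mem_filter, mem_univ, true_and, swap_eq_swap_iff hab, mem_insert, mem_singleton,
        Prod.mk.injEq]
      constructor
      · exact fun h => h.2
      · rintro (⟨rfl, rfl⟩ | ⟨rfl, rfl⟩)
        · exact ⟨hab, Or.inl ⟨rfl, rfl⟩⟩
        · exact ⟨hab.symm, Or.inr ⟨rfl, rfl⟩⟩
    rw [h2, sum_pair (by simp [hab]), Equiv.swap_comm b a, two_mul]
  · intro p hp
    exact mem_filter.2 ⟨mem_univ _, p.1, p.2, (mem_filter.1 hp).2, rfl⟩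

open Classical in
lemma two_mul_factorCount_succ (r : ℕ) (π : Equiv.Perm V) (p : Setoid V) :
    2 * factorCount (r + 1) π p = ∑ a, ∑ b ∈ univ.erase a,
      ∑ p' : Setoid V with p'.glue a b = p, factorCount r (Equiv.swap a b * π) p' := by
  set D : Equiv.Perm V → ℕ := fun t => #{T : Fin r → Equiv.Perm V | (∀ i, (T i).IsSwap) ∧
    t * (List.ofFn T).prod = π ∧ conn (Fin.cons t T : Fin (r + 1) → Equiv.Perm V) = p} with hD
  have h1 : factorCount (r + 1) π p = ∑ t with t.IsSwap, D t := by
    rw [factorCount, card_filter,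
      ← (Fin.consEquiv (fun _ => Equiv.Perm V)).sum_comp, Fintype.sum_prod_type, sum_filter]
    refine sum_congr rfl fun t _ => ?_
    rw [hD]
    simp only [Fin.consEquiv, Equiv.coe_fn_mk, Fin.forall_fin_succ, Fin.cons_zero, Fin.cons_succ,
      List.ofFn_succ, List.prod_cons]
    split_ifs with ht
    · rw [card_filter]
      simp only [ht, true_and]
    · simp [ht]
  rw [h1, ← sum_swap]
  refine sum_congr rfl fun a _ => sum_congr rfl fun b _ => ?_
  simp only [hD]
  rw [card_eq_sum_card_fiberwise (f := conn)
    (t := ({p' : Setoid V | p'.glue a b = p} : Finset (Setoid V)))]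
  · refine sum_congr rfl fun p' hp' => ?_
    rw [factorCount, filter_filter]
    congr 1
    ext T
    simp only [mem_filter, mem_univ, true_and, conn_cons_swap]
    have : Equiv.swap a b * (List.ofFn T).prod = π ↔ (List.ofFn T).prod = Equiv.swap a b * π := by
      constructor
      · rintro rfl
        rw [Equiv.swap_mul_self_mul]
      · intro h
        rw [h, Equiv.swap_mul_self_mul]
    rw [this]
    have hp := (mem_filter.1 hp').2
    constructor
    · rintro ⟨⟨h1, h2, h3⟩, h4⟩
      exact ⟨h1, h2, h4⟩
    · rintro ⟨h1, h2, rfl⟩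
      exact ⟨⟨h1, h2, hp⟩, rfl⟩
  · intro T hT
    rw [mem_coe, mem_filter, conn_cons_swap] at hT
    exact mem_coe.2 (mem_filter.2 ⟨mem_univ _, hT.2.2.2⟩)

end FactorCount

section GenusZeroWeight

variable {V : Type*} [Fintype V] [DecidableEq V]

namespace Setoid

lemma blkIn_glue_of_notMem {s : Setoid V} {a b : V} {B : Finset V} (ha : a ∉ B) (hb : b ∉ B) :
    (s.glue a b).blkIn B = s.blkIn B := by
  ext C
  rw [mem_blkIn, mem_blkIn, blk_glue, mem_insert, mem_erase, mem_erase]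
  constructor
  · rintro ⟨rfl | h, hC⟩
    · exact absurd (hC (mem_union_left _ (s.self_mem_cls a))) ha
    · exact ⟨h.2.2, hC⟩
  · rintro ⟨h, hC⟩
    refine ⟨Or.inr ⟨?_, ?_, h⟩, hC⟩
    · rintro rfl
      exact hb (hC (s.self_mem_cls b))
    · rintro rfl
      exact ha (hC (s.self_mem_cls a))

lemma mem_blkIn_glue_erase {s : Setoid V} {a b : V} (hab : ¬ s a b) {B D : Finset V} :
    D ∈ ((s.glue a b).blkIn B).erase ((s.glue a b).cls a) ↔
      D ∈ s.blk ∧ D ≠ s.cls a ∧ D ≠ s.cls b ∧ D ⊆ B := by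
  rw [mem_erase, mem_blkIn, blk_glue, cls_glue_left, mem_insert, mem_erase, mem_erase]
  constructor
  · rintro ⟨h1, h2 | h2, h3⟩
    · exact absurd h2 h1
    · exact ⟨h2.2.2, h2.2.1, h2.1, h3⟩
  · rintro ⟨h1, h2, h3, h4⟩
    refine ⟨?_, Or.inr ⟨h3, h2, h1⟩, h4⟩
    rintro rfl
    exact union_cls_notMem_blk hab h1

lemma card_blkIn_glue {s p : Setoid V} {a b : V} (hab : ¬ s a b) (h : s ≤ p) (hp : p a b) :
    #((s.glue a b).blkIn (p.cls a)) + 1 = #(s.blkIn (p.cls a)) := by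
  have ha : s.cls a ∈ s.blkIn (p.cls a) := mem_blkIn.2 ⟨s.cls_mem_blk a, cls_subset_cls h a⟩
  have hb : s.cls b ∈ (s.blkIn (p.cls a)).erase (s.cls a) := by
    refine mem_erase.2 ⟨fun h => hab (s.symm (cls_eq_iff.1 h)), mem_blkIn.2 ⟨s.cls_mem_blk b, ?_⟩⟩
    rw [cls_eq_iff.2 hp]
    exact cls_subset_cls h b
  have hg : s.glue a b ≤ p := glue_le_iff.2 ⟨h, hp⟩
  have hc : (s.glue a b).cls a ∈ (s.glue a b).blkIn (p.cls a) :=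
    mem_blkIn.2 ⟨cls_mem_blk _ a, cls_subset_cls hg a⟩
  rw [← card_erase_add_one hc, ← card_erase_add_one ha, ← card_erase_add_one hb]
  congr 3
  ext D
  rw [mem_blkIn_glue_erase hab, mem_erase, mem_erase, mem_blkIn]
  tauto

lemma disjoint_cls {s : Setoid V} {a b : V} (hab : ¬ s a b) : Disjoint (s.cls a) (s.cls b) :=
  disjoint_of_mem_blk (s.cls_mem_blk a) (s.cls_mem_blk b) fun h => hab (cls_eq_iff.1 h)

omit [DecidableEq V] in
lemma card_cls_pos (s : Setoid V) (a : V) : 0 < #(s.cls a) :=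
  card_pos.2 ⟨a, s.self_mem_cls a⟩

/-- The factor of a block `B` in Hurwitz's formula, where `B` contains `m` classes of `s`. -/
noncomputable def blockWeight (s : Setoid V) (B : Finset V) : ℚ :=
  (#B : ℚ) ^ ((#(s.blkIn B) : ℤ) - 3)

/-- The normalized number of minimal factorizations of a permutation with cycles `s`
whose orbit partition is `p`. -/
noncomputable def genusZeroWeight (s p : Setoid V) : ℚ :=
  (∏ C ∈ s.blk, hurwitzWeight #C) * ∏ B ∈ p.blk, s.blockWeight B

lemma blockWeight_pos {s p : Setoid V} {B : Finset V} (hB : B ∈ p.blk) : 0 < s.blockWeight B := by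
  have := card_pos_of_mem_blk hB
  unfold blockWeight
  positivity

lemma prod_erase_blockWeight_glue {s p : Setoid V} {a b : V} (hp : p a b) :
    ∏ B ∈ p.blk.erase (p.cls a), (s.glue a b).blockWeight B =
      ∏ B ∈ p.blk.erase (p.cls a), s.blockWeight B := by
  refine prod_congr rfl fun B hB => ?_
  obtain ⟨h1, h2⟩ := mem_erase.1 hB
  rw [blockWeight, blockWeight, blkIn_glue_of_notMem]
  · exact fun h => h1 (eq_cls_of_mem h2 h)
  · intro h
    rw [cls_eq_iff.2 hp] at h1
    exact h1 (eq_cls_of_mem h2 h)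

lemma prod_hurwitzWeight_glue {s : Setoid V} {a b : V} (hab : ¬ s a b) :
    (∏ C ∈ (s.glue a b).blk, hurwitzWeight #C) *
        (hurwitzWeight #(s.cls a) * hurwitzWeight #(s.cls b)) =
      (∏ C ∈ s.blk, hurwitzWeight #C) * hurwitzWeight (#(s.cls a) + #(s.cls b)) := by
  rw [← card_union_of_disjoint (disjoint_cls hab)]
  exact prod_blk_glue hab fun C => hurwitzWeight #C

lemma genusZeroWeight_glue_left {s p : Setoid V} {a b : V} (hab : ¬ s a b) (h : s ≤ p)
    (hp : p a b) :
    genusZeroWeight (s.glue a b) p = genusZeroWeight s p / s.blockWeight (p.cls a) *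
      (hurwitzWeight (#(s.cls a) + #(s.cls b)) /
        (hurwitzWeight #(s.cls a) * hurwitzWeight #(s.cls b)) *
        (#(p.cls a) : ℚ) ^ ((#(s.blkIn (p.cls a)) : ℤ) - 4)) := by
  have hw := prod_hurwitzWeight_glue hab
  have hb := blockWeight_pos (s := s) (p.cls_mem_blk a)
  have h1 := hurwitzWeight_pos (s.card_cls_pos a)
  have h2 := hurwitzWeight_pos (s.card_cls_pos b)
  have h3 : (s.glue a b).blockWeight (p.cls a) =
      (#(p.cls a) : ℚ) ^ ((#(s.blkIn (p.cls a)) : ℤ) - 4) := by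
    rw [blockWeight, ← card_blkIn_glue hab h hp]
    congr 1
    push_cast
    ring
  rw [← eq_div_iff (by positivity)] at hw
  rw [genusZeroWeight, genusZeroWeight, ← mul_prod_erase _ _ (p.cls_mem_blk a),
    prod_erase_blockWeight_glue hp, h3, hw, ← mul_prod_erase p.blk _ (p.cls_mem_blk a)]
  field_simp

lemma genusZeroWeight_of_glue {s p : Setoid V} {a b : V} (h : s ≤ p) (hab : ¬ p a b) :
    genusZeroWeight s p =
      genusZeroWeight (s.glue a b) (p.glue a b) / (s.glue a b).blockWeight ((p.glue a b).cls a) *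
        (hurwitzWeight #(s.cls a) * hurwitzWeight #(s.cls b) /
          hurwitzWeight #((s.glue a b).cls a)) *
        (s.blockWeight (p.cls a) * s.blockWeight (p.cls b)) := by
  have hab' : ¬ s a b := fun h' => hab (h h')
  have hw := prod_hurwitzWeight_glue hab'
  have hp := prod_blk_glue hab s.blockWeight
  have hb := blockWeight_pos (s := s.glue a b) ((p.glue a b).cls_mem_blk a)
  have hb' := blockWeight_pos (s := s) ((p.glue a b).cls_mem_blk a)
  have h1 := hurwitzWeight_pos (s.card_cls_pos a)
  have h2 := hurwitzWeight_pos (s.card_cls_pos b)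
  have h3 := hurwitzWeight_pos (Nat.add_pos_left (s.card_cls_pos a) #(s.cls b))
  rw [← mul_prod_erase _ _ ((p.glue a b).cls_mem_blk a), ← cls_glue_left] at hp
  rw [genusZeroWeight, genusZeroWeight, ← mul_prod_erase (p.glue a b).blk _
    ((p.glue a b).cls_mem_blk a), prod_erase_blockWeight_glue (p.glue_rel a b)]
  rw [cls_glue_left s, card_union_of_disjoint (disjoint_cls hab')]
  rw [← eq_div_iff (by positivity)] at hw
  have hp' : ∏ B ∈ p.blk, s.blockWeight B =
      (∏ B ∈ (p.glue a b).blk.erase ((p.glue a b).cls a), s.blockWeight B) *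
        (s.blockWeight (p.cls a) * s.blockWeight (p.cls b)) := by
    refine mul_right_cancel₀ hb'.ne' ?_
    rw [← hp]
    ring
  rw [hw, hp']
  field_simp

end Setoid

end GenusZeroWeight

section SplitBlock

variable {V : Type*}

namespace Setoid

/-- The refinement of `p` obtained by cutting along `X`. -/
def cut (p : Setoid V) (X : Finset V) : Setoid V where
  r x y := p x y ∧ (x ∈ X ↔ y ∈ X)
  iseqv := ⟨fun x => ⟨p.refl x, Iff.rfl⟩, fun h => ⟨p.symm h.1, h.2.symm⟩,
    fun h h' => ⟨p.trans h.1 h'.1, h.2.trans h'.2⟩⟩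

lemma cut_apply {p : Setoid V} {X : Finset V} {x y : V} :
    p.cut X x y ↔ p x y ∧ (x ∈ X ↔ y ∈ X) := Iff.rfl

variable [Fintype V] [DecidableEq V]

omit [DecidableEq V] in
lemma cut_glue_cls {p : Setoid V} {a b : V} (hab : ¬ p a b) :
    (p.glue a b).cut (p.cls a) = p := by
  ext x y
  rw [cut_apply, glue_apply, mem_cls, mem_cls]
  constructor
  · rintro ⟨h | ⟨hx, hy⟩ | ⟨hx, hy⟩, h'⟩
    · exact h
    · exact absurd (p.trans (h'.1 (p.symm hx)) hy) hab
    · exact absurd (p.trans (h'.2 (p.symm hy)) hx) hab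
  · intro h
    exact ⟨Or.inl h, fun h' => p.trans h' h, fun h' => p.trans h' (p.symm h)⟩

lemma cut_glue {p : Setoid V} {X : Finset V} {a b : V} (hab : p a b) (hX : X ⊆ p.cls a)
    (ha : a ∈ X) (hb : b ∉ X) : (p.cut X).glue a b = p := by
  refine le_antisymm (glue_le_iff.2 ⟨fun x y h => h.1, hab⟩) fun x y h => ?_
  rw [glue_apply, cut_apply, cut_apply, cut_apply, cut_apply, cut_apply]
  by_cases hx : x ∈ X <;> by_cases hy : y ∈ X
  · exact Or.inl ⟨h, by simp [hx, hy]⟩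
  · have hxa := p.symm (mem_cls.1 (hX hx))
    exact Or.inr (Or.inl ⟨⟨hxa, by simp [hx, ha]⟩,
      p.trans (p.symm h) (p.trans hxa hab), by simp [hy, hb]⟩)
  · have hya := p.symm (mem_cls.1 (hX hy))
    exact Or.inr (Or.inr ⟨⟨p.trans h (p.trans hya hab), by simp [hx, hb]⟩, hya, by simp [hy, ha]⟩)
  · exact Or.inl ⟨h, by simp [hx, hy]⟩

omit [DecidableEq V] in
lemma cls_cut {p : Setoid V} {X : Finset V} {a : V} (hX : X ⊆ p.cls a) (ha : a ∈ X) :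
    (p.cut X).cls a = X := by
  ext y
  rw [mem_cls, cut_apply]
  exact ⟨fun h => h.2.1 ha, fun h => ⟨mem_cls.1 (hX h), by simp [ha, h]⟩⟩

lemma blkIn_cls_left {s p : Setoid V} {a b : V} (hab : ¬ p a b) (h : s ≤ p) :
    s.blkIn (p.cls a) = insert (s.cls a)
      {D ∈ ((s.glue a b).blkIn ((p.glue a b).cls a)).erase ((s.glue a b).cls a) |
        D ⊆ p.cls a} := by
  ext D
  rw [mem_insert, mem_filter, mem_blkIn_glue_erase fun h' => hab (h h'), mem_blkIn]
  constructor
  · rintro ⟨h1, h2⟩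
    by_cases hD : D = s.cls a
    · exact Or.inl hD
    · refine Or.inr ⟨⟨h1, hD, ?_, h2.trans (cls_subset_cls (p.le_glue a b) a)⟩, h2⟩
      rintro rfl
      exact hab (mem_cls.1 (h2 (s.self_mem_cls b)))
  · rintro (rfl | ⟨h1, h2⟩)
    · exact ⟨s.cls_mem_blk a, cls_subset_cls h a⟩
    · exact ⟨h1.1, h2⟩

lemma blkIn_cls_right {s p : Setoid V} {a b : V} (hab : ¬ p a b) (h : s ≤ p) :
    s.blkIn (p.cls b) = insert (s.cls b)
      {D ∈ ((s.glue a b).blkIn ((p.glue a b).cls a)).erase ((s.glue a b).cls a) |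
        ¬ D ⊆ p.cls a} := by
  have hd := disjoint_cls hab
  ext D
  rw [mem_insert, mem_filter, mem_blkIn_glue_erase fun h' => hab (h h'), mem_blkIn]
  constructor
  · rintro ⟨h1, h2⟩
    obtain ⟨x, hx⟩ := nonempty_of_mem_blk h1
    by_cases hD : D = s.cls b
    · exact Or.inl hD
    · refine Or.inr ⟨⟨h1, ?_, hD, ?_⟩, fun h' => disjoint_left.1 hd (h' hx) (h2 hx)⟩
      · rintro rfl
        exact hab (p.symm (mem_cls.1 (h2 (s.self_mem_cls a))))
      · rw [cls_glue_left]
        exact h2.trans subset_union_right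
  · rintro (rfl | ⟨h1, h2⟩)
    · exact ⟨s.cls_mem_blk b, cls_subset_cls h b⟩
    · refine ⟨h1.1, ?_⟩
      obtain ⟨x, hx⟩ := nonempty_of_mem_blk h1.1
      have hDx := eq_cls_of_mem h1.1 hx
      have hxB := h1.2.2.2 hx
      rw [cls_glue_left, mem_union, ← cls_subset_iff h (p.cls_mem_blk a),
        ← cls_subset_iff h (p.cls_mem_blk b), ← hDx] at hxB
      exact hxB.resolve_left h2

lemma cls_subset_biUnion_iff {s : Setoid V} {𝒯 : Finset (Finset V)} (h𝒯 : 𝒯 ⊆ s.blk)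
    {D : Finset V} (hD : D ∈ s.blk) : D ⊆ 𝒯.biUnion id ↔ D ∈ 𝒯 := by
  constructor
  · intro h
    obtain ⟨x, hx⟩ := nonempty_of_mem_blk hD
    obtain ⟨E, hE, hx'⟩ := mem_biUnion.1 (h hx)
    rwa [eq_cls_of_mem hD hx, ← eq_cls_of_mem (h𝒯 hE) hx']
  · exact fun h => subset_biUnion_of_mem id h

lemma cls_eq_biUnion_blkIn {s p : Setoid V} (h : s ≤ p) (a : V) :
    p.cls a = (s.blkIn (p.cls a)).biUnion id := by
  ext x
  rw [mem_biUnion]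
  constructor
  · intro hx
    exact ⟨s.cls x, mem_blkIn.2 ⟨s.cls_mem_blk x, (cls_subset_iff h (p.cls_mem_blk a)).2 hx⟩,
      s.self_mem_cls x⟩
  · rintro ⟨C, hC, hx⟩
    exact (mem_blkIn.1 hC).2 hx

lemma rel_mem_biUnion_iff {s : Setoid V} {𝒯 : Finset (Finset V)} (h𝒯 : 𝒯 ⊆ s.blk) {x y : V}
    (hxy : s x y) : x ∈ 𝒯.biUnion id ↔ y ∈ 𝒯.biUnion id := by
  simp only [mem_biUnion, id]
  refine exists_congr fun C => and_congr_right fun hC => ?_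
  constructor
  · intro hx
    rw [eq_cls_of_mem (h𝒯 hC) hx]
    exact mem_cls.2 hxy
  · intro hy
    rw [eq_cls_of_mem (h𝒯 hC) hy]
    exact mem_cls.2 (s.symm hxy)

open Classical in
/-- The ways to split the block of `a` into two blocks separating `a` from `b`, compatibly
with `s`, are indexed by sets of classes. -/
lemma sum_split {s p : Setoid V} {a b : V} (hab : ¬ s a b) (h : s.glue a b ≤ p) {M : Type*}
    [AddCommMonoid M] (F : Finset (Finset V) → M) :
    ∑ q : Setoid V with q.glue a b = p ∧ ¬ q a b ∧ s ≤ q,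
        F {D ∈ ((s.glue a b).blkIn (p.cls a)).erase ((s.glue a b).cls a) | D ⊆ q.cls a} =
      ∑ A ∈ (((s.glue a b).blkIn (p.cls a)).erase ((s.glue a b).cls a)).powerset, F A := by
  obtain ⟨hsp, hpab⟩ := glue_le_iff.1 h
  set R := ((s.glue a b).blkIn (p.cls a)).erase ((s.glue a b).cls a) with hR
  have hRmem : ∀ D, D ∈ R ↔ D ∈ s.blk ∧ D ≠ s.cls a ∧ D ≠ s.cls b ∧ D ⊆ p.cls a :=
    fun D => mem_blkIn_glue_erase hab
  have hcut : ∀ A ⊆ R, insert (s.cls a) A ⊆ s.blk ∧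
      (insert (s.cls a) A).biUnion id ⊆ p.cls a ∧ a ∈ (insert (s.cls a) A).biUnion id ∧
      b ∉ (insert (s.cls a) A).biUnion id := by
    intro A hA
    have hsub : insert (s.cls a) A ⊆ s.blk :=
      insert_subset (s.cls_mem_blk a) fun D hD => ((hRmem D).1 (hA hD)).1
    refine ⟨hsub, ?_, ?_, ?_⟩
    · refine biUnion_subset.2 fun D hD => ?_
      rcases mem_insert.1 hD with rfl | hD
      · exact cls_subset_cls hsp a
      · exact ((hRmem D).1 (hA hD)).2.2.2
    · exact mem_biUnion.2 ⟨_, mem_insert_self _ _, s.self_mem_cls a⟩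
    · intro hb
      obtain ⟨D, hD, hbD⟩ := mem_biUnion.1 hb
      rcases mem_insert.1 hD with rfl | hD
      · exact hab (mem_cls.1 hbD)
      · have := (hRmem D).1 (hA hD)
        exact this.2.2.1 (eq_cls_of_mem this.1 hbD)
  refine sum_bij' (fun q _ => {D ∈ R | D ⊆ q.cls a})
    (fun A _ => p.cut ((insert (s.cls a) A).biUnion id)) ?_ ?_ ?_ ?_ ?_
  · exact fun q _ => mem_powerset.2 (filter_subset _ _)
  · intro A hA
    obtain ⟨h1, h2, h3, h4⟩ := hcut A (mem_powerset.1 hA)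
    refine mem_filter.2 ⟨mem_univ _, cut_glue hpab h2 h3 h4, ?_, ?_⟩
    · exact fun h' => h4 (h'.2.1 h3)
    · exact fun x y hxy => ⟨hsp hxy, rel_mem_biUnion_iff h1 hxy⟩
  · intro q hq
    obtain ⟨-, rfl, hq, hsq⟩ := mem_filter.1 hq
    rw [hR, ← blkIn_cls_left hq hsq, ← cls_eq_biUnion_blkIn hsq, cut_glue_cls hq]
  · intro A hA
    obtain ⟨h1, h2, h3, h4⟩ := hcut A (mem_powerset.1 hA)
    rw [cls_cut h2 h3]
    ext D
    rw [mem_filter]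
    constructor
    · rintro ⟨hD, hD'⟩
      rw [cls_subset_biUnion_iff h1 ((hRmem D).1 hD).1] at hD'
      exact (mem_insert.1 hD').resolve_left ((hRmem D).1 hD).2.1
    · intro hD
      exact ⟨mem_powerset.1 hA hD, subset_biUnion_of_mem id (mem_insert_of_mem hD)⟩
  · exact fun q _ => rfl

end Setoid

end SplitBlock

section CutJoinSum

variable {V : Type*} [Fintype V] [DecidableEq V]

open Setoid

lemma Setoid.blockWeight_eq_of_blkIn {s p : Setoid V} (h : s ≤ p) {a : V} {A : Finset (Finset V)}
    (hA : s.blkIn (p.cls a) = insert (s.cls a) A) (ha : s.cls a ∉ A) :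
    s.blockWeight (p.cls a) =
      (#(s.cls a) + ∑ D ∈ A, (#D : ℚ)) ^ ((#A : ℤ) - 2) := by
  rw [blockWeight, ← sum_card_blkIn h (p.cls_mem_blk a), hA, sum_insert ha,
    card_insert_of_notMem ha]
  push_cast
  congr 1
  ring

open Classical in
lemma sum_split_genusZeroWeight {s p : Setoid V} {a b : V} (hab : ¬ s a b) (h : s.glue a b ≤ p) :
    ∑ q : Setoid V with q.glue a b = p ∧ ¬ q a b ∧ s ≤ q, genusZeroWeight s q =
      genusZeroWeight (s.glue a b) p / (s.glue a b).blockWeight (p.cls a) *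
        (hurwitzWeight #(s.cls a) * hurwitzWeight #(s.cls b) /
          hurwitzWeight #((s.glue a b).cls a) *
        ∑ A ∈ (((s.glue a b).blkIn (p.cls a)).erase ((s.glue a b).cls a)).powerset,
          (#(s.cls a) + ∑ D ∈ A, (#D : ℚ)) ^ ((#A : ℤ) - 2) *
          (#(s.cls b) + ∑ D ∈ ((s.glue a b).blkIn (p.cls a)).erase ((s.glue a b).cls a) \ A,
            (#D : ℚ)) ^
            ((#(((s.glue a b).blkIn (p.cls a)).erase ((s.glue a b).cls a) \ A) : ℤ) - 2)) := by
  rw [← sum_split hab h, mul_sum, mul_sum]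
  refine sum_congr rfl fun q hq => ?_
  obtain ⟨-, rfl, hq, hsq⟩ := mem_filter.1 hq
  have h1 := blkIn_cls_left hq hsq
  have h2 := blkIn_cls_right hq hsq
  rw [filter_not] at h2
  rw [genusZeroWeight_of_glue hsq hq, blockWeight_eq_of_blkIn hsq h1,
    blockWeight_eq_of_blkIn hsq h2]
  · ring
  · intro h
    have := (mem_sdiff.1 h).1
    rw [mem_blkIn_glue_erase hab] at this
    exact this.2.2.1 rfl
  · intro h
    have := (mem_filter.1 h).1
    rw [mem_blkIn_glue_erase hab] at this
    exact this.2.1 rfl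

open Classical in
/-- The cut-and-join recursion for the closed formula, within one block. -/
lemma sum_block_genusZeroWeight {π : Equiv.Perm V} {p : Setoid V} (h : cyc π ≤ p) {B : Finset V}
    (hB : B ∈ p.blk) :
    ∑ a ∈ B, (∑ b ∈ B \ (cyc π).cls a, genusZeroWeight ((cyc π).glue a b) p +
      ∑ b ∈ ((cyc π).cls a).erase a, ∑ q : Setoid V with q.glue a b = p ∧ ¬ q a b ∧
        cyc (Equiv.swap a b * π) ≤ q, genusZeroWeight (cyc (Equiv.swap a b * π)) q) =
      genusZeroWeight (cyc π) p * (2 * (#B + #((cyc π).blkIn B) - 2)) := by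
  set s := cyc π with hs
  set S := s.blkIn B with hS
  have hK : (#B : ℚ) = ∑ C ∈ S, (#C : ℚ) := by
    rw [← sum_card_blkIn h hB]
    push_cast
    rfl
  have hSne : S.Nonempty := by
    obtain ⟨x, hx⟩ := nonempty_of_mem_blk hB
    exact ⟨s.cls x, mem_blkIn.2 ⟨s.cls_mem_blk x, (cls_subset_iff h hB).2 hx⟩⟩
  have hpos : ∀ C ∈ S, 0 < #C := fun C hC => card_pos_of_mem_blk (mem_blkIn.1 hC).1
  have key := hurwitz_cut_join_identity (fun C : Finset V => #C) S hSne hpos #B hK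
  set Φ : Finset V → ℚ := fun C =>
    ∑ D ∈ S.erase C, (#D : ℚ) * (hurwitzWeight (#C + #D) /
        (hurwitzWeight #C * hurwitzWeight #D) * (#B : ℚ) ^ ((#S : ℤ) - 4)) +
      ∑ c ∈ Ico 1 #C, hurwitzWeight c * hurwitzWeight (#C - c) / hurwitzWeight #C *
        ∑ A ∈ (S.erase C).powerset, (c + ∑ D ∈ A, (#D : ℚ)) ^ ((#A : ℤ) - 2) *
          ((#C - c : ℕ) + ∑ D ∈ S.erase C \ A, (#D : ℚ)) ^ ((#(S.erase C \ A) : ℤ) - 2) with hΦ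
  have hterm : ∀ a ∈ B, ∑ b ∈ B \ s.cls a, genusZeroWeight (s.glue a b) p +
      ∑ b ∈ (s.cls a).erase a, ∑ q : Setoid V with q.glue a b = p ∧ ¬ q a b ∧
        cyc (Equiv.swap a b * π) ≤ q, genusZeroWeight (cyc (Equiv.swap a b * π)) q =
      genusZeroWeight s p / s.blockWeight B * Φ (s.cls a) := by
    intro a ha
    obtain rfl := eq_cls_of_mem hB ha
    rw [hΦ]
    dsimp only
    rw [mul_add]
    congr 1
    · have h1 := sum_mem_block_sdiff h hB a (fun D => hurwitzWeight (#(s.cls a) + #D) /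
        (hurwitzWeight #(s.cls a) * hurwitzWeight #D) * (#(p.cls a) : ℚ) ^ ((#S : ℤ) - 4))
      simp only [nsmul_eq_mul] at h1
      rw [← h1, mul_sum]
      refine sum_congr rfl fun b hb => ?_
      obtain ⟨hb1, hb2⟩ := mem_sdiff.1 hb
      rw [mem_cls] at hb1 hb2
      exact genusZeroWeight_glue_left hb2 h hb1
    · rw [← sum_card_cls_swap_mul π a, mul_sum]
      refine sum_congr rfl fun b hb => ?_
      obtain ⟨hb1, hb2⟩ := mem_erase.1 hb
      have hg := glue_cyc_swap_mul hb1.symm (mem_cls.1 hb2)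
      have hn := not_cyc_swap_mul hb1.symm (mem_cls.1 hb2)
      have hc : #(s.cls a) - #((cyc (Equiv.swap a b * π)).cls a) =
          #((cyc (Equiv.swap a b * π)).cls b) := by
        rw [hs, ← hg, cls_glue_left, card_union_of_disjoint (disjoint_cls hn)]
        omega
      rw [hc, sum_split_genusZeroWeight hn (by rw [hg]; exact h), hg]
  have hfin : ∑ C ∈ S, #C • (genusZeroWeight s p / s.blockWeight B * Φ C) =
      genusZeroWeight s p / s.blockWeight B *
        (2 * (#B + #S - 2) * (#B : ℚ) ^ ((#S : ℤ) - 3)) := by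
    rw [← key, mul_sum]
    refine sum_congr rfl fun C _ => ?_
    rw [nsmul_eq_mul]
    ring
  rw [sum_congr rfl hterm,
    sum_mem_block h hB (fun C => genusZeroWeight s p / s.blockWeight B * Φ C), hfin]
  have hb := (blockWeight_pos (s := s) hB).ne'
  have hb' : (#B : ℚ) ^ ((#S : ℤ) - 3) = s.blockWeight B := rfl
  rw [hb']
  field_simp

end CutJoinSum

section FactorCountFormula

variable {V : Type*} [Fintype V] [DecidableEq V]

open Setoid

lemma card_blk_swap_mul_of_not_rel {π : Equiv.Perm V} {a b : V} (hab : ¬ cyc π a b) :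
    #(cyc (Equiv.swap a b * π)).blk + 1 = #(cyc π).blk := by
  rw [cyc_swap_mul_of_not_rel hab, card_blk_glue hab]

lemma card_blk_swap_mul_of_rel {π : Equiv.Perm V} {a b : V} (hne : a ≠ b) (hab : cyc π a b) :
    #(cyc (Equiv.swap a b * π)).blk = #(cyc π).blk + 1 := by
  rw [← card_blk_glue (not_cyc_swap_mul hne hab), glue_cyc_swap_mul hne hab]

lemma card_blk_le_card_blk_glue (s : Setoid V) (a b : V) : #s.blk ≤ #(s.glue a b).blk + 1 := by
  by_cases hab : s a b
  · rw [glue_eq_self hab]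
    omega
  · exact (card_blk_glue hab).ge

/-- The Riemann–Hurwitz inequality for factorizations into transpositions. -/
lemma le_of_factorCount_ne_zero {r : ℕ} {π : Equiv.Perm V} {p : Setoid V}
    (h : factorCount r π p ≠ 0) :
    cyc π ≤ p ∧ Fintype.card V + #(cyc π).blk ≤ r + 2 * #p.blk := by
  classical
  induction r generalizing π p with
  | zero =>
    rw [factorCount_zero] at h
    split_ifs at h with h'
    · obtain ⟨rfl, rfl⟩ := h'
      have h1 : cyc (1 : Equiv.Perm V) = ⊥ := by
        rw [← le_bot_iff, cyc_le_iff]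
        exact fun x => rfl
      rw [h1]
      refine ⟨le_rfl, ?_⟩
      have h2 : Fintype.card V ≤ #(⊥ : Setoid V).blk := by
        have hinj : Function.Injective (⊥ : Setoid V).cls := fun x y hxy => cls_eq_iff.1 hxy
        rw [blk, card_image_of_injective _ hinj, card_univ]
      omega
    · exact absurd rfl h
  | succ r ih =>
    have h2 : 2 * factorCount (r + 1) π p ≠ 0 := by omega
    rw [two_mul_factorCount_succ] at h2
    obtain ⟨a, -, ha⟩ := exists_ne_zero_of_sum_ne_zero h2
    obtain ⟨b, hb, hab⟩ := exists_ne_zero_of_sum_ne_zero ha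
    obtain ⟨q, hq, hq'⟩ := exists_ne_zero_of_sum_ne_zero hab
    have hne : a ≠ b := (ne_of_mem_erase hb).symm
    obtain rfl := (mem_filter.1 hq).2
    obtain ⟨h3, h4⟩ := ih hq'
    refine ⟨(cyc_le_glue_swap_mul π a b).trans
      (glue_le_iff.2 ⟨h3.trans (q.le_glue a b), q.glue_rel a b⟩), ?_⟩
    by_cases hc : cyc π a b
    · have h5 := card_blk_swap_mul_of_rel hne hc
      have h6 := card_blk_le_card_blk_glue q a b
      omega
    · have h5 := card_blk_swap_mul_of_not_rel hc
      have h6 : q a b := h3 (by rw [cyc_swap_mul_of_not_rel hc]; exact glue_rel _ _ _)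
      rw [glue_eq_self h6]
      omega

open Classical in
lemma sum_factorCount_of_not_rel {r : ℕ} {π : Equiv.Perm V} {p : Setoid V} {a b : V}
    (hab : ¬ cyc π a b) (hp : p a b) :
    ∑ q : Setoid V with q.glue a b = p, factorCount r (Equiv.swap a b * π) q =
      factorCount r (Equiv.swap a b * π) p := by
  refine sum_eq_single_of_mem p (mem_filter.2 ⟨mem_univ _, glue_eq_self hp⟩) fun q hq hne => ?_
  by_contra h
  have h1 : q a b := (le_of_factorCount_ne_zero h).1
    (by rw [cyc_swap_mul_of_not_rel hab]; exact glue_rel _ _ _)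
  have h2 := (mem_filter.1 hq).2
  rw [glue_eq_self h1] at h2
  exact hne h2

open Classical in
lemma sum_factorCount_of_rel {r : ℕ} {π : Equiv.Perm V} {p : Setoid V} {a b : V}
    (hne : a ≠ b) (hab : cyc π a b)
    (hr : Fintype.card V + #(cyc π).blk = r + 1 + 2 * #p.blk) :
    ∑ q : Setoid V with q.glue a b = p, factorCount r (Equiv.swap a b * π) q =
      ∑ q : Setoid V with q.glue a b = p ∧ ¬ q a b ∧ cyc (Equiv.swap a b * π) ≤ q,
        factorCount r (Equiv.swap a b * π) q := by
  symm
  refine sum_subset (fun q hq => mem_filter.2 ⟨mem_univ _, (mem_filter.1 hq).2.1⟩) ?_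
  intro q hq hq'
  by_contra h
  obtain ⟨h1, h2⟩ := le_of_factorCount_ne_zero h
  have h3 := (mem_filter.1 hq).2
  refine hq' (mem_filter.2 ⟨mem_univ _, h3, fun h4 => ?_, h1⟩)
  rw [glue_eq_self h4] at h3
  subst h3
  rw [card_blk_swap_mul_of_rel hne hab] at h2
  omega

lemma genusZeroWeight_bot : genusZeroWeight (⊥ : Setoid V) ⊥ = 1 := by
  have hcard : ∀ B ∈ (⊥ : Setoid V).blk, #B = 1 := by
    intro B hB
    obtain ⟨x, -, rfl⟩ := mem_image.1 hB
    rw [card_eq_one]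
    refine ⟨x, ?_⟩
    ext y
    rw [mem_cls, mem_singleton]
    exact ⟨fun h => (show x = y from h).symm, fun h => h ▸ Setoid.refl' _ _⟩
  rw [genusZeroWeight, prod_eq_one, prod_eq_one, one_mul]
  · intro B hB
    rw [blockWeight, hcard B hB, Nat.cast_one, one_zpow]
  · intro B hB
    rw [hcard B hB, hurwitzWeight]
    norm_num

/-- The number of minimal factorizations of `π` into transpositions with orbit partition `p`. -/
theorem factorCount_eq {r : ℕ} {π : Equiv.Perm V} {p : Setoid V} (h : cyc π ≤ p)
    (hr : Fintype.card V + #(cyc π).blk = r + 2 * #p.blk) :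
    (factorCount r π p : ℚ) = r.factorial * genusZeroWeight (cyc π) p := by
  classical
  induction r generalizing π p with
  | zero =>
    have h1 := card_blk_le_of_le h
    have h2 := (cyc π).card_blk_le
    obtain rfl : p = ⊥ := eq_bot_of_card_le_card_blk (by omega)
    have h3 := le_bot_iff.1 h
    obtain rfl : π = 1 := by
      exact Equiv.ext fun x => (cyc_le_iff.1 h x : x = π x).symm
    rw [factorCount_zero, if_pos ⟨rfl, rfl⟩, h3, genusZeroWeight_bot]
    simp
  | succ r ih =>
    have hstep : ∀ a, ∑ b ∈ univ.erase a, ((∑ q : Setoid V with q.glue a b = p,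
        factorCount r (Equiv.swap a b * π) q : ℕ) : ℚ) =
        r.factorial * (∑ b ∈ p.cls a \ (cyc π).cls a, genusZeroWeight ((cyc π).glue a b) p +
          ∑ b ∈ ((cyc π).cls a).erase a, ∑ q : Setoid V with q.glue a b = p ∧ ¬ q a b ∧
            cyc (Equiv.swap a b * π) ≤ q, genusZeroWeight (cyc (Equiv.swap a b * π)) q) := by
      intro a
      have hsub : (p.cls a).erase a ⊆ univ.erase a := erase_subset_erase _ (subset_univ _)
      rw [← sum_subset hsub]
      · have hdisj : Disjoint (p.cls a \ (cyc π).cls a) (((cyc π).cls a).erase a) :=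
          disjoint_sdiff_self_left.mono_right (erase_subset _ _)
        have hunion : (p.cls a).erase a =
            (p.cls a \ (cyc π).cls a) ∪ ((cyc π).cls a).erase a := by
          ext b
          have h1 : b ∈ (cyc π).cls a → b ∈ p.cls a := fun hb => cls_subset_cls h a hb
          have h2 : b ∉ (cyc π).cls a → b ≠ a := by
            rintro hb rfl
            exact hb (self_mem_cls _ _)
          simp only [mem_erase, mem_union, mem_sdiff]
          tauto
        rw [hunion, sum_union hdisj, mul_add, mul_sum, mul_sum]
        congr 1
        · refine sum_congr rfl fun b hb => ?_
          obtain ⟨hb1, hb2⟩ := mem_sdiff.1 hb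
          rw [mem_cls] at hb1 hb2
          rw [sum_factorCount_of_not_rel hb2 hb1, ih, cyc_swap_mul_of_not_rel hb2]
          · rw [cyc_swap_mul_of_not_rel hb2]
            exact glue_le_iff.2 ⟨h, hb1⟩
          · have := card_blk_swap_mul_of_not_rel hb2
            omega
        · refine sum_congr rfl fun b hb => ?_
          obtain ⟨hb1, hb2⟩ := mem_erase.1 hb
          rw [mem_cls] at hb2
          rw [sum_factorCount_of_rel hb1.symm hb2 hr, mul_sum]
          push_cast
          refine sum_congr rfl fun q hq => ?_
          obtain ⟨-, rfl, hq1, hq2⟩ := mem_filter.1 hq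
          rw [ih hq2]
          have h1 := card_blk_swap_mul_of_rel hb1.symm hb2
          have h2 := card_blk_glue hq1
          omega
      · intro b hb hb'
        rw [sum_eq_zero, Nat.cast_zero]
        intro q hq
        obtain rfl := (mem_filter.1 hq).2
        exact absurd (mem_erase.2 ⟨ne_of_mem_erase hb, mem_cls.2 (q.glue_rel a b)⟩) hb'
    have h2 : (2 : ℚ) * factorCount (r + 1) π p =
        r.factorial * ∑ B ∈ p.blk, genusZeroWeight (cyc π) p *
          (2 * (#B + #((cyc π).blkIn B) - 2)) := by
      have := congrArg (Nat.cast : ℕ → ℚ) (two_mul_factorCount_succ r π p)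
      rw [Nat.cast_mul, Nat.cast_sum] at this
      simp only [Nat.cast_sum (s := univ.erase _), Nat.cast_ofNat] at this
      rw [this, sum_congr rfl fun a _ => hstep a, sum_univ_eq_sum_blk p, mul_sum]
      refine sum_congr rfl fun B hB => ?_
      rw [← sum_block_genusZeroWeight h hB, mul_sum]
      refine sum_congr rfl fun a ha => ?_
      rw [← eq_cls_of_mem hB ha]
    have h3 : ∑ B ∈ p.blk, genusZeroWeight (cyc π) p *
          (2 * ((#B : ℚ) + #((cyc π).blkIn B) - 2)) =
        2 * ((r + 1) * genusZeroWeight (cyc π) p) := by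
      have h4 : (Fintype.card V : ℚ) + #(cyc π).blk = r + 1 + 2 * #p.blk := by exact_mod_cast hr
      rw [← sum_card_blk p, ← sum_card_blkIn_blk h] at h4
      push_cast at h4
      rw [← mul_sum, ← mul_sum, sum_sub_distrib, sum_add_distrib, h4, sum_const, nsmul_eq_mul]
      ring
    rw [h3] at h2
    rw [Nat.factorial_succ]
    push_cast
    linarith

end FactorCountFormula

section Transitive

variable {V : Type*}

open Setoid

lemma conn_le_apply_of_mem_closure {r : ℕ} (T : Fin r → Equiv.Perm V) {g : Equiv.Perm V}
    (hg : g ∈ Subgroup.closure (Set.range T)) (x : V) : conn T x (g x) := by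
  induction hg using Subgroup.closure_induction generalizing x with
  | mem g hg =>
    obtain ⟨i, rfl⟩ := hg
    exact conn_rel T i x
  | one => exact (conn T).refl x
  | mul g h _ _ ihg ihh => exact (conn T).trans (ihh x) (ihg (h x))
  | inv g _ ih => exact (conn T).symm (by simpa using ih (g⁻¹ x))

/-- A tuple of permutations has a single joint orbit iff it generates a transitive group. -/
lemma conn_eq_top_iff {r : ℕ} (T : Fin r → Equiv.Perm V) :
    conn T = ⊤ ↔ ∀ x y : V, ∃ g ∈ Subgroup.closure (Set.range T), g x = y := by
  constructor
  · intro h x y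
    have hle : conn T ≤ MulAction.orbitRel (Subgroup.closure (Set.range T)) V := by
      refine conn_le_iff.2 fun i z => Setoid.symm' _ ?_
      rw [MulAction.orbitRel_apply]
      exact ⟨⟨T i, Subgroup.subset_closure ⟨i, rfl⟩⟩, rfl⟩
    rw [h] at hle
    have hxy := hle (show (⊤ : Setoid V) y x from trivial)
    rw [MulAction.orbitRel_apply] at hxy
    obtain ⟨g, hg⟩ := hxy
    exact ⟨g, g.2, hg⟩
  · intro h
    refine Setoid.eq_top_iff.2 fun x y => ?_
    obtain ⟨g, hg, rfl⟩ := h x y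
    exact conn_le_apply_of_mem_closure T hg x

lemma closure_range_union_inv_prod {r : ℕ} (T : Fin r → Equiv.Perm V) :
    Subgroup.closure (Set.range T ∪ {(List.ofFn T).prod⁻¹}) = Subgroup.closure (Set.range T) := by
  refine le_antisymm ((Subgroup.closure_le _).2 (Set.union_subset Subgroup.subset_closure ?_))
    (Subgroup.closure_mono Set.subset_union_left)
  rw [Set.singleton_subset_iff]
  refine inv_mem (list_prod_mem fun g hg => ?_)
  exact Subgroup.subset_closure (by simpa using hg)

end Transitive

section CycleType

open Setoid

lemma cyc_inv {V : Type*} (σ : Equiv.Perm V) : cyc σ⁻¹ = cyc σ :=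
  Setoid.ext fun _ _ => Equiv.Perm.sameCycle_inv

variable {V : Type*} [Fintype V] [DecidableEq V]

lemma cls_cyc_of_mem_support {σ : Equiv.Perm V} {x : V} (hx : x ∈ σ.support) :
    (cyc σ).cls x = (σ.cycleOf x).support := by
  ext y
  rw [mem_cls, Equiv.Perm.mem_support_cycleOf_iff]
  exact (and_iff_left hx).symm

lemma cls_cyc_of_notMem_support {σ : Equiv.Perm V} {x : V} (hx : x ∉ σ.support) :
    (cyc σ).cls x = {x} := by
  ext y
  rw [mem_cls, mem_singleton]
  constructor
  · intro h
    exact ((h : σ.SameCycle x y).eq_of_left (Equiv.Perm.notMem_support.1 hx)).symm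
  · rintro rfl
    exact (cyc σ).refl _

lemma blk_cyc (σ : Equiv.Perm V) :
    (cyc σ).blk = σ.cycleFactorsFinset.image Equiv.Perm.support ∪
      σ.supportᶜ.image ({·} : V → Finset V) := by
  ext C
  simp only [blk, mem_image, mem_univ, true_and, mem_union, mem_compl]
  constructor
  · rintro ⟨x, rfl⟩
    by_cases hx : x ∈ σ.support
    · exact Or.inl ⟨σ.cycleOf x, Equiv.Perm.cycleOf_mem_cycleFactorsFinset_iff.2 hx,
        (cls_cyc_of_mem_support hx).symm⟩
    · exact Or.inr ⟨x, hx, (cls_cyc_of_notMem_support hx).symm⟩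
  · rintro (⟨c, hc, rfl⟩ | ⟨x, hx, rfl⟩)
    · obtain ⟨x, hx⟩ := (Equiv.Perm.mem_cycleFactorsFinset_iff.1 hc).1.nonempty_support
      refine ⟨x, ?_⟩
      rw [cls_cyc_of_mem_support (Equiv.Perm.mem_cycleFactorsFinset_support_le hc hx),
        ← Equiv.Perm.cycle_is_cycleOf hx hc]
    · exact ⟨x, cls_cyc_of_notMem_support hx⟩

/-- The cycle lengths of a permutation, including fixed points. -/
lemma map_card_blk_cyc (σ : Equiv.Perm V) :
    (cyc σ).blk.val.map card =
      σ.cycleType + Multiset.replicate (Fintype.card V - #σ.support) 1 := by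
  have hinj : Set.InjOn Equiv.Perm.support (σ.cycleFactorsFinset : Set (Equiv.Perm V)) := by
    intro c hc d hd hcd
    obtain ⟨x, hx⟩ := (Equiv.Perm.mem_cycleFactorsFinset_iff.1 hc).1.nonempty_support
    rw [Equiv.Perm.cycle_is_cycleOf hx hc, Equiv.Perm.cycle_is_cycleOf (hcd ▸ hx) hd]
  have hdisj : Disjoint (σ.cycleFactorsFinset.image Equiv.Perm.support)
      (σ.supportᶜ.image ({·} : V → Finset V)) := by
    rw [disjoint_left]
    simp only [mem_image, mem_compl]
    rintro _ ⟨c, hc, rfl⟩ ⟨x, hx, hxc⟩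
    exact hx (Equiv.Perm.mem_cycleFactorsFinset_support_le hc (hxc ▸ mem_singleton_self x))
  rw [blk_cyc, ← disjUnion_eq_union _ _ hdisj, disjUnion_val, Multiset.map_add,
    image_val_of_injOn hinj, image_val_of_injOn (singleton_injective.injOn), Multiset.map_map,
    Multiset.map_map, Equiv.Perm.cycleType_def]
  congr 1
  rw [Multiset.map_congr (g := fun _ => 1) rfl (fun x _ => by exact card_singleton x),
    Multiset.map_const', ← Finset.card_def, card_compl]

end CycleType

section CountByType

lemma eq_filter_add_replicate {α : Multiset ℕ} (hpos : ∀ a ∈ α, 0 < a) :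
    α = α.filter (2 ≤ ·) + Multiset.replicate (α.count 1) 1 := by
  conv_lhs => rw [← Multiset.filter_add_not (2 ≤ ·) α]
  rw [← Multiset.filter_eq']
  congr 1
  refine Multiset.filter_congr fun a ha => ?_
  have := hpos a ha
  omega

lemma count_one_add_sum_filter {α : Multiset ℕ} (hpos : ∀ a ∈ α, 0 < a) :
    (α.filter (2 ≤ ·)).sum + α.count 1 = α.sum := by
  conv_rhs => rw [eq_filter_add_replicate hpos]
  simp

lemma fullCycleType_eq_iff {k : ℕ} {α : Multiset ℕ} (hpos : ∀ a ∈ α, 0 < a) (hsum : α.sum = k)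
    (σ : Equiv.Perm (Fin k)) : fullCycleType σ = α ↔ σ.cycleType = α.filter (2 ≤ ·) := by
  constructor
  · rintro rfl
    rw [fullCycleType, Multiset.filter_add, Multiset.filter_eq_self.2, Multiset.filter_eq_nil.2,
      add_zero]
    · intro a ha
      rw [Multiset.eq_of_mem_replicate ha]
      omega
    · exact fun a ha => Equiv.Perm.two_le_of_mem_cycleType ha
  · intro h
    have h1 := count_one_add_sum_filter hpos
    rw [← h, Equiv.Perm.sum_cycleType] at h1
    conv_rhs => rw [eq_filter_add_replicate hpos]
    rw [fullCycleType, h]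
    congr 2
    omega

lemma card_filter_fullCycleType {k : ℕ} {α : Multiset ℕ} (hpos : ∀ a ∈ α, 0 < a)
    (hsum : α.sum = k) :
    (#{σ : Equiv.Perm (Fin k) | fullCycleType σ = α} : ℚ) = conjClassCard k α := by
  have h1 := count_one_add_sum_filter hpos
  have hcard := Equiv.Perm.card_of_cycleType_mul_eq (Fin k) (α.filter (2 ≤ ·))
  rw [if_pos ⟨by rw [Fintype.card_fin]; omega, fun a ha => (Multiset.mem_filter.1 ha).2⟩,
    Fintype.card_fin, show k - (α.filter (2 ≤ ·)).sum = α.count 1 by omega] at hcard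
  have hprod : α.prod = (α.filter (2 ≤ ·)).prod := by
    conv_lhs => rw [eq_filter_add_replicate hpos]
    simp
  have hfact : ∏ j ∈ α.toFinset, (α.count j).factorial = (α.count 1).factorial *
      ∏ j ∈ (α.filter (2 ≤ ·)).toFinset, ((α.filter (2 ≤ ·)).count j).factorial := by
    rw [prod_subset (s₂ := insert 1 (α.filter (2 ≤ ·)).toFinset), prod_insert (by simp)]
    · congr 1
      refine prod_congr rfl fun j hj => ?_
      rw [Multiset.count_filter_of_pos (by simpa using (Multiset.mem_filter.1
        (Multiset.mem_toFinset.1 hj)).2)]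
    · intro j hj
      have hj' := Multiset.mem_toFinset.1 hj
      have := hpos j hj'
      rw [mem_insert, Multiset.mem_toFinset, Multiset.mem_filter]
      by_cases h : j = 1
      · exact Or.inl h
      · exact Or.inr ⟨hj', by omega⟩
    · intro j _ hj
      rw [Multiset.count_eq_zero.2 (fun h => hj (Multiset.mem_toFinset.2 h)), Nat.factorial_zero]
  have hne : α.prod ≠ 0 := by
    rw [Ne, Multiset.prod_eq_zero_iff]
    exact fun h => (hpos 0 h).ne rfl
  have hne' : ∏ j ∈ α.toFinset, (α.count j).factorial ≠ 0 :=
    prod_ne_zero_iff.2 fun j _ => Nat.factorial_ne_zero _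
  rw [conjClassCard, eq_div_iff (by exact_mod_cast mul_ne_zero hne hne')]
  simp only [fullCycleType_eq_iff hpos hsum]
  rw [← hcard, ← Nat.cast_prod, hfact, hprod]
  push_cast
  ring

end CountByType

section HurwitzCount

open Setoid

lemma blk_top {V : Type*} [Fintype V] [DecidableEq V] [Nonempty V] :
    (⊤ : Setoid V).blk = {univ} := by
  have h : ∀ x : V, (⊤ : Setoid V).cls x = univ := fun x => by
    ext y
    simp [mem_cls, Setoid.top_def]
  rw [blk, show (⊤ : Setoid V).cls = fun _ => univ from funext h, image_const univ_nonempty]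

lemma genusZeroWeight_top {V : Type*} [Fintype V] [DecidableEq V] [Nonempty V] (s : Setoid V) :
    genusZeroWeight s ⊤ =
      (∏ C ∈ s.blk, hurwitzWeight #C) * (Fintype.card V : ℚ) ^ ((#s.blk : ℤ) - 3) := by
  rw [genusZeroWeight, blk_top, prod_singleton, blockWeight, blkIn,
    filter_true_of_mem fun C _ => subset_univ C, card_univ]

lemma hurwitzCount0_eq_sum (k r : ℕ) (α : Multiset ℕ) :
    hurwitzCount0 k r α =
      ∑ σ : Equiv.Perm (Fin k) with fullCycleType σ = α, factorCount r σ⁻¹ ⊤ := by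
  classical
  rw [hurwitzCount0, Nat.card_eq_fintype_card, Fintype.card_subtype,
    card_eq_sum_card_fiberwise (f := Prod.snd)
      (t := {σ : Equiv.Perm (Fin k) | fullCycleType σ = α})
      (fun T hT => by simpa using (mem_filter.1 hT).2.2.1)]
  refine sum_congr rfl fun σ hσ => ?_
  have hσ' := (mem_filter.1 hσ).2
  rw [factorCount]
  refine card_bij' (fun T _ => T.1) (fun T _ => (T, σ)) ?_ ?_ ?_ ?_
  · rintro ⟨T, τ⟩ hT
    simp only [mem_filter, mem_univ, true_and] at hT ⊢
    obtain ⟨⟨h1, -, h3, h4⟩, rfl⟩ := hT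
    rw [← eq_inv_iff_mul_eq_one] at h3
    refine ⟨h1, h3, (conn_eq_top_iff T).2 ?_⟩
    rwa [← closure_range_union_inv_prod, h3, inv_inv]
  · intro T hT
    simp only [mem_filter, mem_univ, true_and] at hT ⊢
    obtain ⟨h1, h3, h4⟩ := hT
    refine ⟨⟨h1, hσ', by rw [h3, inv_mul_cancel], ?_⟩, trivial⟩
    rw [conn_eq_top_iff, ← closure_range_union_inv_prod, h3, inv_inv] at h4
    exact h4
  · rintro ⟨T, τ⟩ hT
    rw [← (mem_filter.1 hT).2]
  · intro T _
    rfl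

end HurwitzCount

end Preliminaries

/-- **Hurwitz's formula.** For `k ≥ 1` and a partition `α = (α₁,…,α_m)` of `k`,
`μ_{0,m}^{0,k}(α) = (|c_α|/k!)·(k+m-2)!·k^{m-3}·Π_{i=1}^m α_i^{α_i}/(α_i-1)!`
(an identity of rational numbers; `k^{m-3}` is a `ℤ`-power). -/
theorem hurwitz_genus_zero_formula (k : ℕ) (hk : 1 ≤ k) (α : Multiset ℕ)
    (hpos : ∀ a ∈ α, 0 < a) (hsum : α.sum = k) :
    hurwitzSphere 0 k α =
      conjClassCard k α / (k.factorial : ℚ) * ((k + α.card - 2).factorial : ℚ) *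
        (k : ℚ) ^ ((α.card : ℤ) - 3) *
        (α.map fun (a : ℕ) => (a : ℚ) ^ a / ((a - 1).factorial : ℚ)).prod := by
  have : NeZero k := ⟨by omega⟩
  have hα : 0 < α.card := by
    rw [Multiset.card_pos]
    rintro rfl
    simp at hsum
    omega
  have hterm : ∀ σ ∈ ({σ | fullCycleType σ = α} : Finset (Equiv.Perm (Fin k))),
      (factorCount (k + α.card - 2) σ⁻¹ ⊤ : ℚ) = ((k + α.card - 2).factorial : ℚ) *
        ((α.map hurwitzWeight).prod * (k : ℚ) ^ ((α.card : ℤ) - 3)) := by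
    intro σ hσ
    have hmap : (cyc σ).blk.val.map Finset.card = α := by
      rw [map_card_blk_cyc, Fintype.card_fin]
      exact (Finset.mem_filter.1 hσ).2
    have hcard : (cyc σ).blk.card = α.card := by
      rw [← hmap, Multiset.card_map, Finset.card_def]
    rw [factorCount_eq le_top, cyc_inv, genusZeroWeight_top, hcard, Fintype.card_fin,
      Finset.prod_eq_multiset_prod, ← hmap, Multiset.map_map]
    · rfl
    · rw [cyc_inv, hcard, blk_top, Finset.card_singleton, Fintype.card_fin]
      omega
  rw [hurwitzSphere, mul_zero, add_zero, hurwitzCount0_eq_sum, Nat.cast_sum,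
    Finset.sum_congr rfl hterm, Finset.sum_const, nsmul_eq_mul, card_filter_fullCycleType hpos hsum]
  unfold hurwitzWeight
  ring
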